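/- Let β and ρ be simple closed curves in ℝ² with β ∩ ρ ≠ ∅, and suppose that every point of β ∩ ρ is a crossing of β and ρ. Then there are at least 4 distinct digons of (β, ρ). -/

import Mathlib

/-- A simple closed curve: a subset of ℝ² homeomorphic to the unit circle. -/
def IsSimpleClosedCurve (c : Set (ℝ × ℝ)) : Prop :=
  Nonempty (c ≃ₜ Metric.sphere (0 : EuclideanSpace ℝ (Fin 2)) 1)

/-- An arc: a subset of ℝ² homeomorphic to the closed interval [0,1]. -/
def IsArc (A : Set (ℝ × ℝ)) : Prop :=
  Nonempty (A ≃ₜ Set.Icc (0 : ℝ) 1)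

/-- `a` is an endpoint of the arc `A` : `a ∈ A` and `A \ {a}` is connected. -/
def IsEndpointOf (a : ℝ × ℝ) (A : Set (ℝ × ℝ)) : Prop :=
  a ∈ A ∧ IsConnected (A \ {a})

/-- A digon of the pair of simple closed curves `(β, ρ)`. -/
def IsDigon (β ρ α γ : Set (ℝ × ℝ)) : Prop :=
  IsArc α ∧ IsArc γ ∧ α ⊆ β ∧ γ ⊆ ρ ∧
  ∃ x y : ℝ × ℝ, x ≠ y ∧
    {a | IsEndpointOf a α} = {x, y} ∧
    {a | IsEndpointOf a γ} = {x, y} ∧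
    β ∩ γ = {x, y} ∧
    ρ ∩ α = {x, y}

/-- `z` is a crossing of `β` and `ρ`. -/
def IsCrossing (β ρ : Set (ℝ × ℝ)) (z : ℝ × ℝ) : Prop :=
  ∃ (U : Set (ℝ × ℝ)) (_ : IsOpen U) (hz : z ∈ U) (h : U ≃ₜ ℝ × ℝ),
    h ⟨z, hz⟩ = (0, 0) ∧
    ⇑h '' {p : U | (p : ℝ × ℝ) ∈ β} = {q : ℝ × ℝ | q.2 = 0} ∧
    ⇑h '' {p : U | (p : ℝ × ℝ) ∈ ρ} = {q : ℝ × ℝ | q.1 = 0}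

/-- `z` is a tangential intersection of `β` and `ρ`. -/
def IsTangential (β ρ : Set (ℝ × ℝ)) (z : ℝ × ℝ) : Prop :=
  ∃ (U : Set (ℝ × ℝ)) (_ : IsOpen U) (hz : z ∈ U) (h : U ≃ₜ ℝ × ℝ),
    h ⟨z, hz⟩ = (0, 0) ∧
    ⇑h '' {p : U | (p : ℝ × ℝ) ∈ β} = {q : ℝ × ℝ | q.2 = 0} ∧
    ⇑h '' {p : U | (p : ℝ × ℝ) ∈ ρ} ⊆ {q : ℝ × ℝ | 0 ≤ q.2} ∧
    ⇑h '' {p : U | (p : ℝ × ℝ) ∈ ρ} ∩ {q : ℝ × ℝ | q.2 = 0} = {((0 : ℝ), (0 : ℝ))}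

section Preliminaries

open Set Filter Topology

/-- Two points are joined off `K` if some preconnected set disjoint from `K` contains both. -/
def JoinedOff {X : Type*} [TopologicalSpace X] (K : Set X) (p q : X) : Prop :=
  ∃ S, IsPreconnected S ∧ Disjoint S K ∧ p ∈ S ∧ q ∈ S

section JoinedOff

variable {X Y : Type*} [TopologicalSpace X] [TopologicalSpace Y] {K K' : Set X} {p q r : X}

lemma JoinedOff.symm (h : JoinedOff K p q) : JoinedOff K q p := by
  obtain ⟨S, h1, h2, h3, h4⟩ := h
  exact ⟨S, h1, h2, h4, h3⟩

lemma JoinedOff.trans (h : JoinedOff K p q) (h' : JoinedOff K q r) : JoinedOff K p r := by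
  obtain ⟨S, h1, h2, h3, h4⟩ := h
  obtain ⟨T, k1, k2, k3, k4⟩ := h'
  exact ⟨S ∪ T, h1.union q h4 k3 k1, disjoint_union_left.2 ⟨h2, k2⟩, .inl h3, .inr k4⟩

lemma JoinedOff.left_notMem (h : JoinedOff K p q) : p ∉ K := by
  obtain ⟨S, h1, h2, h3, h4⟩ := h
  exact disjoint_left.1 h2 h3

lemma JoinedOff.right_notMem (h : JoinedOff K p q) : q ∉ K := h.symm.left_notMem

lemma JoinedOff.image {K : Set X} (e : X ≃ₜ Y) (h : JoinedOff K p q) :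
    JoinedOff (e '' K) (e p) (e q) := by
  obtain ⟨S, h1, h2, h3, h4⟩ := h
  exact ⟨e '' S, h1.image _ e.continuous.continuousOn,
    (disjoint_image_iff e.injective).2 h2, mem_image_of_mem _ h3, mem_image_of_mem _ h4⟩

end JoinedOff

/-- `f` has a continuous logarithm on `K`. -/
def HasLogOn {X : Type*} [TopologicalSpace X] (f : X → ℂ) (K : Set X) : Prop :=
  ∃ g : X → ℂ, ContinuousOn g K ∧ ∀ z ∈ K, Complex.exp (g z) = f z

section HasLogOn

variable {X : Type*} [TopologicalSpace X]

lemma HasLogOn.mono {f : X → ℂ} {K L : Set X} (h : HasLogOn f L) (hKL : K ⊆ L) : HasLogOn f K := by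
  obtain ⟨g, hg, hg'⟩ := h
  exact ⟨g, hg.mono hKL, fun z hz => hg' z (hKL hz)⟩

lemma HasLogOn.congr {f f' : X → ℂ} {K : Set X} (h : HasLogOn f K) (hf : ∀ z ∈ K, f z = f' z) :
    HasLogOn f' K := by
  obtain ⟨g, hg, hg'⟩ := h
  exact ⟨g, hg, fun z hz => (hg' z hz).trans (hf z hz)⟩

lemma HasLogOn.mul {f f' : X → ℂ} {K : Set X} (h : HasLogOn f K) (h' : HasLogOn f' K) :
    HasLogOn (fun z => f z * f' z) K := by
  obtain ⟨g, hg, hg'⟩ := h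
  obtain ⟨k, hk, hk'⟩ := h'
  exact ⟨fun z => g z + k z, hg.add hk, fun z hz => by
    rw [Complex.exp_add, hg' z hz, hk' z hz]⟩

lemma HasLogOn.inv {f : X → ℂ} {K : Set X} (h : HasLogOn f K) :
    HasLogOn (fun z => (f z)⁻¹) K := by
  obtain ⟨g, hg, hg'⟩ := h
  exact ⟨fun z => - g z, hg.neg, fun z hz => by
    rw [Complex.exp_neg, hg' z hz]⟩

lemma hasLogOn_of_mem_slitPlane {f : X → ℂ} {K : Set X} (hf : ContinuousOn f K)
    (h : ∀ z ∈ K, f z ∈ Complex.slitPlane) : HasLogOn f K :=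
  ⟨fun z => Complex.log (f z), hf.clog h, fun z hz =>
    Complex.exp_log (Complex.slitPlane_ne_zero (h z hz))⟩

/-- A non-vanishing function on a simply connected space has a continuous logarithm. -/
lemma hasLogOn_univ [SimplyConnectedSpace X] [LocallyPathConnectedSpace X] {f : X → ℂ}
    (hf : Continuous f) (h : ∀ x, f x ≠ 0) (K : Set X) : HasLogOn f K := by
  obtain ⟨x₀⟩ : Nonempty X := inferInstance
  obtain ⟨F, ⟨-, hF⟩, -⟩ := Complex.isCoveringMapOn_exp.existsUnique_continuousMap_lifts
    (⟨f, hf⟩ : C(X, ℂ)) (a₀ := x₀) (e₀ := Complex.log (f x₀)) (Complex.exp_log (h x₀))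
    (fun x => h x)
  exact ⟨F, F.continuous.continuousOn, fun z _ => congrFun hF z⟩

/-- On a preconnected set, two continuous logarithms of a function differ by a constant. -/
lemma exists_sub_eq_of_exp_eq {C : Set X} (hC : IsPreconnected C) {g k : X → ℂ}
    (hg : ContinuousOn g C) (hk : ContinuousOn k C)
    (h : ∀ z ∈ C, Complex.exp (g z) = Complex.exp (k z)) :
    ∃ c : ℂ, Complex.exp c = 1 ∧ ∀ z ∈ C, g z = k z + c := by
  rcases C.eq_empty_or_nonempty with rfl | ⟨z₀, hz₀⟩
  · exact ⟨0, Complex.exp_zero, by simp⟩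
  have hn : ∀ z ∈ C, ∃ n : ℤ, g z - k z = n * (2 * Real.pi * Complex.I) := by
    intro z hz
    obtain ⟨n, hn⟩ := Complex.exp_eq_exp_iff_exists_int.1 (h z hz)
    exact ⟨n, by rw [hn]; ring⟩
  refine ⟨g z₀ - k z₀, ?_, fun z hz => ?_⟩
  · rw [Complex.exp_sub, h z₀ hz₀, div_self (Complex.exp_ne_zero _)]
  · have hcont : ContinuousOn (fun z => ((g z - k z) / (2 * Real.pi * Complex.I)).re) C :=
      Complex.continuous_re.comp_continuousOn ((hg.sub hk).div_const _)
    have hpi : (2 * Real.pi * Complex.I : ℂ) ≠ 0 := Complex.two_pi_I_ne_zero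
    have hP : IsPreconnected ((fun z => ((g z - k z) / (2 * Real.pi * Complex.I)).re) '' C) :=
      hC.image _ hcont
    obtain ⟨n, hn1⟩ := hn z hz
    obtain ⟨m, hm1⟩ := hn z₀ hz₀
    have hsub : ((fun z => ((g z - k z) / (2 * Real.pi * Complex.I)).re) '' C) ⊆
        range ((↑) : ℤ → ℝ) := by
      rintro _ ⟨w, hw, rfl⟩
      obtain ⟨l, hl⟩ := hn w hw
      exact ⟨l, by simp only [hl, mul_div_cancel_right₀ _ hpi]; simp⟩
    have hss := (countable_range ((↑) : ℤ → ℝ)).isTotallyDisconnected _ hsub hP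
      (mem_image_of_mem _ hz) (mem_image_of_mem _ hz₀)
    simp only [hn1, hm1, mul_div_cancel_right₀ _ hpi, Complex.intCast_re] at hss
    have hnm : n = m := by exact_mod_cast hss
    rw [hm1, ← hnm, ← hn1]
    ring

/-- Gluing of logarithms along a theta-shaped configuration. -/
lemma HasLogOn.theta {A B C : Set X} (hA : IsClosed A) (hB : IsClosed B)
    (hC : IsPreconnected C) (hABC : A ∩ B ⊆ C) {f : X → ℂ}
    (h1 : HasLogOn f (A ∪ C)) (h2 : HasLogOn f (B ∪ C)) : HasLogOn f (A ∪ B) := by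
  classical
  obtain ⟨g, hg, hg'⟩ := h1
  obtain ⟨k, hk, hk'⟩ := h2
  obtain ⟨c, hc, hgk⟩ := exists_sub_eq_of_exp_eq hC (hg.mono subset_union_right)
    (hk.mono subset_union_right) fun z hz => by rw [hg' z (.inr hz), hk' z (.inr hz)]
  refine ⟨A.piecewise g (fun z => k z + c), ?_, ?_⟩
  · have e1 : ContinuousOn (A.piecewise g (fun z => k z + c)) A :=
      (hg.mono subset_union_left).congr fun z hz => by simp [hz]
    have e2 : ContinuousOn (A.piecewise g (fun z => k z + c)) B :=
      ((hk.mono subset_union_left).add (continuousOn_const (c := c))).congr fun z hz => by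
        by_cases hzA : z ∈ A
        · simp [hzA, hgk z (hABC ⟨hzA, hz⟩)]
        · simp [hzA]
    exact e1.union_of_isClosed e2 hA hB
  · rintro z hz
    by_cases hzA : z ∈ A
    · simp [hzA, hg' z (.inl hzA)]
    · have hzB : z ∈ B := hz.resolve_left hzA
      simp [hzA, Complex.exp_add, hc, hk' z (.inl hzB)]

end HasLogOn

/-- The identity has no continuous logarithm on a circle around the origin. -/
lemma not_hasLogOn_sphere {R : ℝ} (hR : 0 < R) :
    ¬ HasLogOn (fun z : ℂ => z) (Metric.sphere 0 R) := by
  rintro ⟨g, hg, hg'⟩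
  have hm : ∀ t : ℝ, (R : ℂ) * Complex.exp (t * Complex.I) ∈ Metric.sphere (0 : ℂ) R := by
    intro t
    simp [Complex.norm_exp_ofReal_mul_I, abs_of_pos hR]
  have hRC : (R : ℂ) ≠ 0 := by exact_mod_cast hR.ne'
  obtain ⟨c, -, hc⟩ := exists_sub_eq_of_exp_eq (X := ℝ) (C := univ) isPreconnected_univ
    (g := fun t => g (R * Complex.exp (t * Complex.I)))
    (k := fun t => Complex.log R + t * Complex.I)
    (hg.comp_continuous (by fun_prop) hm).continuousOn (by fun_prop)
    (fun t _ => by rw [hg' _ (hm t), Complex.exp_add, Complex.exp_log hRC])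
  have h0 := hc 0 (mem_univ _)
  have h1 := hc (2 * Real.pi) (mem_univ _)
  have h2 : Complex.exp (((2 * Real.pi : ℝ) : ℂ) * Complex.I) =
      Complex.exp (((0 : ℝ) : ℂ) * Complex.I) := by
    push_cast
    simp [Complex.exp_two_pi_mul_I]
  rw [h2, h0] at h1
  have : ((2 * Real.pi : ℝ) : ℂ) * Complex.I = 0 := by
    have : Complex.log R + ((0 : ℝ) : ℂ) * Complex.I + c = Complex.log R + c := by simp
    rw [this] at h1
    linear_combination -h1
  simp [Real.pi_ne_zero] at this

/-- The complement of a closed disc centred at the origin is preconnected. -/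
lemma isPreconnected_norm_gt (R : ℝ) (hR : 0 ≤ R) : IsPreconnected {z : ℂ | R < ‖z‖} := by
  have : {z : ℂ | R < ‖z‖} =
      (fun q : ℝ × ℝ => (q.1 : ℂ) * Complex.exp (q.2 * Complex.I)) '' (Ioi R ×ˢ univ) := by
    ext z
    constructor
    · intro hz
      exact ⟨(‖z‖, Complex.arg z), ⟨hz, mem_univ _⟩, Complex.norm_mul_exp_arg_mul_I z⟩
    · rintro ⟨⟨r, t⟩, ⟨hr, -⟩, rfl⟩
      simp only [mem_Ioi] at hr
      simp [Complex.norm_exp_ofReal_mul_I, abs_of_pos (hR.trans_lt hr), hr]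
  rw [this]
  exact (isPreconnected_Ioi.prod isPreconnected_univ).image _
    (Continuous.continuousOn (by fun_prop))

/-- Points joined off a compact set `K` have a quotient with a logarithm on `K`. -/
lemma JoinedOff.hasLogOn {K : Set ℂ} (hK : IsCompact K) {a b : ℂ} (h : JoinedOff K a b) :
    HasLogOn (fun z => (z - a) / (z - b)) K := by
  obtain ⟨S, hS, hSK, ha, hb⟩ := h
  have hne : ∀ x ∈ S, ∀ z ∈ K, z - x ≠ 0 := fun x hx z hz h =>
    disjoint_left.1 hSK hx (sub_eq_zero.1 h ▸ hz)
  refine hS.induction₂ (fun a b => HasLogOn (fun z => (z - a) / (z - b)) K) ?_ ?_ ?_ ha hb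
  · intro x hx
    have hxK : Kᶜ ∈ 𝓝 x := hK.isClosed.isOpen_compl.mem_nhds (disjoint_left.1 hSK hx)
    obtain ⟨ε, hε, hball⟩ := Metric.mem_nhds_iff.1 hxK
    filter_upwards [nhdsWithin_le_nhds (Metric.ball_mem_nhds x hε), self_mem_nhdsWithin]
      with y hy hyS
    have key : HasLogOn (fun z => (z - y) / (z - x)) K := by
      refine hasLogOn_of_mem_slitPlane ?_ fun z hz => ?_
      · exact ContinuousOn.div (by fun_prop) (by fun_prop) (hne x hx)
      · have h1 : (z - y) / (z - x) = 1 + (x - y) / (z - x) := by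
          field_simp [hne x hx z hz]; ring
        rw [h1]
        apply Complex.mem_slitPlane_of_norm_lt_one
        rw [norm_div, div_lt_one (norm_pos_iff.2 (hne x hx z hz))]
        have hz' : ε ≤ ‖z - x‖ := by
          by_contra hlt
          exact hball (by simpa [dist_eq_norm] using hlt) hz
        rw [Metric.mem_ball, dist_comm, dist_eq_norm] at hy
        exact hy.trans_le hz'
    exact key.inv.congr fun z hz => by simp
  · intro x y w hx hy hw h1 h2
    exact (h1.mul h2).congr fun z hz => by
      have := hne y hy z hz
      field_simp
  · intro x y hx hy h1
    exact h1.inv.congr fun z hz => by simp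

lemma joinedOff_of_hasLogOn_of_isBounded {K : Set ℂ} (hK : IsCompact K) {a b : ℂ} (ha : a ∉ K)
    (hb : b ∉ K) (hbd : Bornology.IsBounded (connectedComponentIn Kᶜ a))
    (h : HasLogOn (fun z => (z - a) / (z - b)) K) : JoinedOff K a b := by
  classical
  set V := connectedComponentIn Kᶜ a with hV
  have haV : a ∈ V := mem_connectedComponentIn ha
  by_contra hJ
  have hVK : V ⊆ Kᶜ := connectedComponentIn_subset _ _
  have hbV : b ∉ V := fun hbV => hJ ⟨V, isPreconnected_connectedComponentIn,
    disjoint_left.2 fun x hx => hVK hx, haV, hbV⟩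
  have hVo : IsOpen V := hK.isClosed.isOpen_compl.connectedComponentIn
  have hfr : frontier V ⊆ K := by
    intro x hx
    by_contra hxK
    have hxV : x ∉ V := by
      rw [hVo.frontier_eq] at hx
      exact hx.2
    have hUo : IsOpen (connectedComponentIn Kᶜ x) := hK.isClosed.isOpen_compl.connectedComponentIn
    obtain ⟨y, hy1, hy2⟩ := mem_closure_iff.1 (frontier_subset_closure hx) _ hUo
      (mem_connectedComponentIn hxK)
    have e1 := connectedComponentIn_eq hy1
    have e2 := connectedComponentIn_eq hy2
    exact hxV (by rw [hV, e2, ← e1]; exact mem_connectedComponentIn hxK)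
  obtain ⟨g, hg, hg'⟩ := h
  obtain ⟨G, hG⟩ := ContinuousMap.exists_restrict_eq hK.isClosed
    (⟨K.domRestrict g, hg.domRestrict⟩ : C(K, ℂ))
  have hGg : ∀ z ∈ K, G z = g z := fun z hz => congrArg (fun F : C(K, ℂ) => F ⟨z, hz⟩) hG
  set F : ℂ → ℂ := V.piecewise (fun z => Complex.exp (G z) * (z - b)) (fun z => z - a) with hF
  have hFc : Continuous F := by
    refine Continuous.piecewise (fun z hz => ?_) (by fun_prop) (by fun_prop)
    have hzK := hfr hz
    have hzb : z - b ≠ 0 := fun h => hb (sub_eq_zero.1 h ▸ hzK)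
    rw [hGg z hzK, hg' z hzK, div_mul_cancel₀ _ hzb]
  have hF0 : ∀ z, F z ≠ 0 := by
    intro z
    by_cases hz : z ∈ V
    · have hzb : z - b ≠ 0 := fun h => hbV (sub_eq_zero.1 h ▸ hz)
      simp [hF, hz, hzb]
    · have hza : z - a ≠ 0 := fun h => hz (sub_eq_zero.1 h ▸ haV)
      simp [hF, hz, hza]
  obtain ⟨R₀, hR₀⟩ := hbd.subset_ball 0
  set R := max R₀ (‖a‖ + 1)
  have hRa : ‖a‖ < R := (lt_add_one _).trans_le (le_max_right _ _)
  have hRpos : 0 < R := (norm_nonneg a).trans_lt hRa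
  have h1 : HasLogOn (fun z => z - a) (Metric.sphere 0 R) := by
    refine (hasLogOn_univ hFc hF0 (Metric.sphere 0 R)).congr fun z hz => ?_
    have : z ∉ V := fun hzV => by
      have := hR₀ hzV
      rw [Metric.mem_ball, dist_zero_right] at this
      rw [mem_sphere_zero_iff_norm] at hz
      exact absurd (le_max_left R₀ (‖a‖ + 1)) (not_le.2 (show R < R₀ by linarith))
    simp [hF, this]
  have hnz : ∀ z ∈ Metric.sphere (0 : ℂ) R, z ≠ 0 := by
    rintro z hz rfl
    simp at hz
    exact hRpos.ne hz
  have h2 : HasLogOn (fun z => (z - a) / z) (Metric.sphere 0 R) := by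
    refine hasLogOn_of_mem_slitPlane (ContinuousOn.div (by fun_prop) (by fun_prop) hnz)
      fun z hz => ?_
    have h1 : (z - a) / z = 1 + (- a / z) := by
      have := hnz z hz
      field_simp; ring
    rw [h1]
    apply Complex.mem_slitPlane_of_norm_lt_one
    rw [mem_sphere_zero_iff_norm] at hz
    rw [norm_div, norm_neg, hz, div_lt_one hRpos]
    exact hRa
  refine not_hasLogOn_sphere hRpos ((h1.mul h2.inv).congr fun z hz => ?_)
  have hza : z - a ≠ 0 := fun h => by
    rw [mem_sphere_zero_iff_norm, sub_eq_zero.1 h] at hz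
    exact hRa.ne hz
  have := hnz z hz
  field_simp

/-- **Eilenberg's criterion**. -/
lemma joinedOff_of_hasLogOn {K : Set ℂ} (hK : IsCompact K) {a b : ℂ} (ha : a ∉ K) (hb : b ∉ K)
    (h : HasLogOn (fun z => (z - a) / (z - b)) K) : JoinedOff K a b := by
  by_cases hA : Bornology.IsBounded (connectedComponentIn Kᶜ a)
  · exact joinedOff_of_hasLogOn_of_isBounded hK ha hb hA h
  by_cases hB : Bornology.IsBounded (connectedComponentIn Kᶜ b)
  · exact (joinedOff_of_hasLogOn_of_isBounded hK hb ha hB (h.inv.congr fun z _ => by simp)).symm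
  obtain ⟨R₀, hR₀⟩ := hK.isBounded.subset_closedBall 0
  set R := max R₀ 0
  have hKR : ∀ z ∈ K, ‖z‖ ≤ R := fun z hz => by
    have := hR₀ hz
    rw [Metric.mem_closedBall, dist_zero_right] at this
    exact this.trans (le_max_left _ _)
  have hout : ∀ c, ¬ Bornology.IsBounded (connectedComponentIn Kᶜ c) →
      ∃ z ∈ connectedComponentIn Kᶜ c, R < ‖z‖ := by
    intro c hc
    by_contra! hle
    exact hc ((Metric.isBounded_closedBall (x := (0 : ℂ)) (r := R)).subset fun z hz => by
      simpa using hle z hz)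
  obtain ⟨x, hx, hxR⟩ := hout a hA
  obtain ⟨y, hy, hyR⟩ := hout b hB
  have hd : ∀ c, Disjoint (connectedComponentIn Kᶜ c) K := fun c =>
    disjoint_left.2 fun x hx => connectedComponentIn_subset _ _ hx
  have e1 : JoinedOff K a x :=
    ⟨_, isPreconnected_connectedComponentIn, hd a, mem_connectedComponentIn ha, hx⟩
  have e2 : JoinedOff K b y :=
    ⟨_, isPreconnected_connectedComponentIn, hd b, mem_connectedComponentIn hb, hy⟩
  have e3 : JoinedOff K x y := ⟨_, isPreconnected_norm_gt R (le_max_right _ _),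
    disjoint_left.2 fun z hz hzK => absurd (hKR z hzK) (not_le.2 hz), hxR, hyR⟩
  exact (e1.trans e3).trans e2.symm

lemma JoinedOff.theta_complex {A B C : Set ℂ} (hA : IsCompact A) (hB : IsCompact B)
    (hC : IsCompact C) (hCc : IsPreconnected C) (hABC : A ∩ B ⊆ C) {a b : ℂ}
    (h1 : JoinedOff (A ∪ C) a b) (h2 : JoinedOff (B ∪ C) a b) : JoinedOff (A ∪ B) a b :=
  joinedOff_of_hasLogOn (hA.union hB)
    (fun h => h.elim (fun h => h1.left_notMem (.inl h)) (fun h => h2.left_notMem (.inl h)))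
    (fun h => h.elim (fun h => h1.right_notMem (.inl h)) (fun h => h2.right_notMem (.inl h)))
    (HasLogOn.theta hA.isClosed hB.isClosed hCc hABC (h1.hasLogOn (hA.union hC))
      (h2.hasLogOn (hB.union hC)))

/-- If two points are separated neither by `A ∪ C` nor by `B ∪ C`, where `C` is connected and
contains `A ∩ B`, then they are not separated by `A ∪ B`. -/
lemma JoinedOff.theta {A B C : Set (ℝ × ℝ)} (hA : IsCompact A) (hB : IsCompact B)
    (hC : IsCompact C) (hCc : IsPreconnected C) (hABC : A ∩ B ⊆ C) {a b : ℝ × ℝ}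
    (h1 : JoinedOff (A ∪ C) a b) (h2 : JoinedOff (B ∪ C) a b) : JoinedOff (A ∪ B) a b := by
  let e : ℝ × ℝ ≃ₜ ℂ := Complex.equivRealProdCLM.symm.toHomeomorph
  have h1' := h1.image e
  have h2' := h2.image e
  rw [image_union] at h1' h2'
  have h3 := JoinedOff.theta_complex (hA.image e.continuous) (hB.image e.continuous)
    (hC.image e.continuous) (hCc.image _ e.continuous.continuousOn)
    (by rw [← image_inter e.injective]; exact image_mono hABC) h1' h2'
  rw [← image_union] at h3
  simpa [image_image] using h3.image e.symm

/-- An arc does not separate the plane. -/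
lemma joinedOff_arc {b : ℝ → ℝ × ℝ} (hb : Continuous b) {s t : ℝ} (hst : s ≤ t)
    (hinj : InjOn b (Icc s t)) {p q : ℝ × ℝ} (hp : p ∉ b '' Icc s t) (hq : q ∉ b '' Icc s t) :
    JoinedOff (b '' Icc s t) p q := by
  let e : ℝ × ℝ ≃ₜ ℂ := Complex.equivRealProdCLM.symm.toHomeomorph
  have hK : IsCompact (b '' Icc s t) := isCompact_Icc.image hb
  suffices h : JoinedOff (e '' (b '' Icc s t)) (e p) (e q) by
    simpa [image_image] using h.image e.symm
  have hp' : e p ∉ e '' (b '' Icc s t) := by rwa [e.injective.mem_set_image]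
  have hq' : e q ∉ e '' (b '' Icc s t) := by rwa [e.injective.mem_set_image]
  refine joinedOff_of_hasLogOn (hK.image e.continuous) hp' hq' ?_
  have hne : ∀ w, w ∉ b '' Icc s t → ∀ u, e (b (projIcc s t hst u)) - e w ≠ 0 := by
    intro w hw u h
    exact hw ⟨_, (projIcc s t hst u).2, e.injective (sub_eq_zero.1 h)⟩
  have hcont : Continuous fun u : ℝ => e (b (projIcc s t hst u)) :=
    e.continuous.comp (hb.comp (continuous_subtype_val.comp continuous_projIcc))
  obtain ⟨g, hg, hg'⟩ := hasLogOn_univ (X := ℝ)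
    (f := fun u => (e (b (projIcc s t hst u)) - e p) / (e (b (projIcc s t hst u)) - e q))
    ((hcont.sub continuous_const).div (hcont.sub continuous_const) (hne q hq))
    (fun u => div_ne_zero (hne p hp u) (hne q hq u)) univ
  have hemb : IsClosedEmbedding ((Icc s t).domRestrict fun u => e (b u)) :=
    Continuous.isClosedEmbedding (e.continuous.comp hb).continuousOn.domRestrict
      ((e.injective.comp_injOn hinj).injective)
  obtain ⟨G, hG⟩ := ContinuousMap.exists_extension' hemb
    (⟨fun u : Icc s t => g u, (hg.comp_continuous continuous_subtype_val (fun _ => mem_univ _))⟩ :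
      C(Icc s t, ℂ))
  refine ⟨G, G.continuous.continuousOn, ?_⟩
  rintro _ ⟨_, ⟨u, hu, rfl⟩, rfl⟩
  have h1 : G (e (b u)) = g u := congrFun hG ⟨u, hu⟩
  rw [h1, hg' u (mem_univ _)]
  simp [projIcc_of_mem hst hu]

/-- `b` is a simple closed parametrisation of period one. -/
structure IsLoop (b : ℝ → ℝ × ℝ) : Prop where
  continuous : Continuous b
  eq_iff : ∀ s t, b s = b t ↔ ∃ n : ℤ, s = t + n

namespace IsLoop

variable {b : ℝ → ℝ × ℝ}

lemma add_one (hb : IsLoop b) (t : ℝ) : b (t + 1) = b t := (hb.eq_iff _ _).2 ⟨1, by simp⟩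

lemma sub_one (hb : IsLoop b) (t : ℝ) : b (t - 1) = b t :=
  (hb.eq_iff _ _).2 ⟨-1, by simp [sub_eq_add_neg]⟩

lemma ne_of_lt (hb : IsLoop b) {s t : ℝ} (hst : s < t) (hts : t < s + 1) : b s ≠ b t := by
  intro h
  obtain ⟨n, hn⟩ := (hb.eq_iff _ _).1 h
  have h1 : (n : ℝ) < 0 := by linarith
  have h2 : (-1 : ℝ) < n := by linarith
  have h3 : n < 0 := by exact_mod_cast h1
  have h4 : -1 < n := by exact_mod_cast h2
  omega

lemma injOn_Icc (hb : IsLoop b) {s t : ℝ} (hts : t < s + 1) : InjOn b (Icc s t) := by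
  intro x hx y hy hxy
  rcases lt_trichotomy x y with h | h | h
  · exact (hb.ne_of_lt h (by linarith [hx.1, hy.2]) hxy).elim
  · exact h
  · exact (hb.ne_of_lt h (by linarith [hy.1, hx.2]) hxy.symm).elim

lemma range_eq (hb : IsLoop b) (s : ℝ) : range b = b '' Ico s (s + 1) := by
  refine subset_antisymm ?_ (image_subset_range _ _)
  rintro _ ⟨t, rfl⟩
  refine ⟨t - ⌊t - s⌋, ⟨?_, ?_⟩, (hb.eq_iff _ _).2 ⟨-⌊t - s⌋, by push_cast; ring⟩⟩
  · linarith [Int.floor_le (t - s)]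
  · linarith [Int.lt_floor_add_one (t - s)]

end IsLoop

/-- `φ` is a chart around `z` in which `β` is the horizontal axis. -/
structure IsFlatChart (β : Set (ℝ × ℝ)) (z : ℝ × ℝ) (φ : ℝ × ℝ → ℝ × ℝ) : Prop where
  isOpenEmbedding : IsOpenEmbedding φ
  map_zero : φ (0, 0) = z
  mem_iff : ∀ q, φ q ∈ β ↔ q.2 = 0

lemma IsFlatChart.flip {β : Set (ℝ × ℝ)} {z : ℝ × ℝ} {φ : ℝ × ℝ → ℝ × ℝ}
    (hφ : IsFlatChart β z φ) : IsFlatChart β z (fun q => φ (q.1, -q.2)) where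
  isOpenEmbedding := hφ.isOpenEmbedding.comp
    ((Homeomorph.refl ℝ).prodCongr (Homeomorph.neg ℝ)).isOpenEmbedding
  map_zero := by simpa using hφ.map_zero
  mem_iff q := by rw [hφ.mem_iff]; simp

lemma exists_image_Icc_eq {c : ℝ → ℝ} {s t u : ℝ} (hc : ContinuousOn c (Icc s t))
    (hinj : InjOn c (Icc s t)) (hu : u ∈ Ioo s t) :
    ∃ l r, l < c u ∧ c u < r ∧ c '' Icc s t = Icc l r ∧
      (l = c s ∧ r = c t ∨ l = c t ∧ r = c s) := by
  have hst : s ≤ t := (hu.1.trans hu.2).le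
  have hs := left_mem_Icc.2 hst
  have ht := right_mem_Icc.2 hst
  have hu' := Ioo_subset_Icc_self hu
  rcases le_total (c s) (c t) with h | h
  · have hm := hc.strictMonoOn_of_injOn_Icc hst h hinj
    refine ⟨c s, c t, hm hs hu' hu.1, hm hu' ht hu.2,
      subset_antisymm ?_ (intermediate_value_Icc hst hc), .inl ⟨rfl, rfl⟩⟩
    rintro _ ⟨v, hv, rfl⟩
    exact ⟨hm.monotoneOn hs hv hv.1, hm.monotoneOn hv ht hv.2⟩
  · have hm := hc.strictAntiOn_of_injOn_Icc hst h hinj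
    refine ⟨c t, c s, hm hu' ht hu.2, hm hs hu' hu.1,
      subset_antisymm ?_ (intermediate_value_Icc' hst hc), .inr ⟨rfl, rfl⟩⟩
    rintro _ ⟨v, hv, rfl⟩
    exact ⟨hm.antitoneOn hv ht hv.2, hm.antitoneOn hs hv hv.1⟩

lemma IsFlatChart.exists_param {b : ℝ → ℝ × ℝ} (hb : IsLoop b) {t₀ : ℝ} {φ : ℝ × ℝ → ℝ × ℝ}
    (hφ : IsFlatChart (range b) (b t₀) φ) {δ : ℝ} (hδ : 0 < δ) :
    ∃ ε, 0 < ε ∧ ε < δ ∧ ∃ l r, l < 0 ∧ 0 < r ∧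
      b '' Icc (t₀ - ε) (t₀ + ε) = (fun x => φ (x, 0)) '' Icc l r ∧
      (φ (l, 0) = b (t₀ - ε) ∧ φ (r, 0) = b (t₀ + ε) ∨
        φ (l, 0) = b (t₀ + ε) ∧ φ (r, 0) = b (t₀ - ε)) := by
  have hopen : b ⁻¹' range φ ∈ 𝓝 t₀ :=
    (hφ.isOpenEmbedding.isOpen_range.preimage hb.continuous).mem_nhds ⟨_, hφ.map_zero⟩
  obtain ⟨η, hη, hball⟩ := Metric.mem_nhds_iff.1 hopen
  obtain ⟨ε, hε, hεm⟩ := exists_between (lt_min (lt_min hδ hη) (by norm_num : (0 : ℝ) < 1 / 2))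
  have hεδ : ε < δ := hεm.trans_le ((min_le_left _ _).trans (min_le_left _ _))
  have hεη : ε < η := hεm.trans_le ((min_le_left _ _).trans (min_le_right _ _))
  have hε2 : ε < 1 / 2 := hεm.trans_le (min_le_right _ _)
  have hsub : ∀ t ∈ Icc (t₀ - ε) (t₀ + ε), b t ∈ range φ := fun t ht => by
    refine hball (?_ : t ∈ Metric.ball t₀ η)
    rw [Metric.mem_ball, Real.dist_eq, abs_lt]
    constructor <;> linarith [ht.1, ht.2]
  set ψ := Function.invFun φ
  have hψ : ∀ q, ψ (φ q) = q := Function.leftInverse_invFun hφ.isOpenEmbedding.injective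
  have hψc : ContinuousOn ψ (range φ) := by
    rintro _ ⟨q, rfl⟩
    have : Tendsto (ψ ∘ φ) (𝓝 q) (𝓝 q) := by
      rw [funext hψ (f := ψ ∘ φ) (g := id)]; exact tendsto_id
    have h2 : Tendsto ψ (map φ (𝓝 q)) (𝓝 q) := this
    rw [hφ.isOpenEmbedding.map_nhds_eq] at h2
    have : ContinuousAt ψ (φ q) := by rw [ContinuousAt, hψ]; exact h2
    exact this.continuousWithinAt
  set c : ℝ → ℝ := fun t => (ψ (b t)).1
  have hcb : ∀ t ∈ Icc (t₀ - ε) (t₀ + ε), φ (c t, 0) = b t := by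
    intro t ht
    obtain ⟨q, hq⟩ := hsub t ht
    have hq2 : q.2 = 0 := (hφ.mem_iff q).1 (hq ▸ mem_range_self t)
    have : (c t, (0 : ℝ)) = q := by
      ext
      · simp [c, ← hq, hψ]
      · exact hq2.symm
    rw [this, hq]
  have hcc : ContinuousOn c (Icc (t₀ - ε) (t₀ + ε)) :=
    continuous_fst.comp_continuousOn (hψc.comp hb.continuous.continuousOn hsub)
  have hci : InjOn c (Icc (t₀ - ε) (t₀ + ε)) := fun s hs t ht hst =>
    hb.injOn_Icc (by linarith) hs ht (by rw [← hcb s hs, ← hcb t ht, hst])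
  obtain ⟨l, r, hl, hr, himg, hends⟩ := exists_image_Icc_eq hcc hci (u := t₀)
    ⟨by linarith, by linarith⟩
  have hc0 : c t₀ = 0 := by simp [c, ← hφ.map_zero, hψ]
  rw [hc0] at hl hr
  have hL : t₀ - ε ∈ Icc (t₀ - ε) (t₀ + ε) := left_mem_Icc.2 (by linarith)
  have hR : t₀ + ε ∈ Icc (t₀ - ε) (t₀ + ε) := right_mem_Icc.2 (by linarith)
  refine ⟨ε, hε, hεδ, l, r, hl, hr, ?_, ?_⟩
  · rw [← himg, image_image]
    exact image_congr fun t ht => (hcb t ht).symm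
  · rcases hends with ⟨rfl, rfl⟩ | ⟨rfl, rfl⟩
    · exact .inl ⟨hcb _ hL, hcb _ hR⟩
    · exact .inr ⟨hcb _ hR, hcb _ hL⟩

/-- Around a flat point, a closed curve decomposes into a flat arc and a complementary arc. -/
lemma IsFlatChart.exists_decomposition {b : ℝ → ℝ × ℝ} (hb : IsLoop b) {t₀ : ℝ}
    {φ : ℝ × ℝ → ℝ × ℝ} (hφ : IsFlatChart (range b) (b t₀) φ) :
    ∃ l r s t, l < 0 ∧ 0 < r ∧ s ≤ t ∧ InjOn b (Icc s t) ∧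
      range b = (fun x => φ (x, 0)) '' Icc l r ∪ b '' Icc s t ∧
      φ (l, 0) ∈ b '' Icc s t ∧ φ (r, 0) ∈ b '' Icc s t ∧
      ∀ x ∈ Ioo l r, φ (x, 0) ∉ b '' Icc s t := by
  obtain ⟨ε, hε, hε2, l, r, hl, hr, himg, hends⟩ :=
    hφ.exists_param hb (by norm_num : (0 : ℝ) < 1 / 2)
  have hinj := hφ.isOpenEmbedding.injective
  have hle : t₀ + ε ≤ t₀ + 1 - ε := by linarith
  have hR : b (t₀ + ε) ∈ b '' Icc (t₀ + ε) (t₀ + 1 - ε) := mem_image_of_mem _ (left_mem_Icc.2 hle)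
  have hper : b (t₀ + 1 - ε) = b (t₀ - ε) := by
    rw [← hb.add_one (t₀ - ε)]; congr 1; ring
  have hL : b (t₀ - ε) ∈ b '' Icc (t₀ + ε) (t₀ + 1 - ε) :=
    ⟨_, right_mem_Icc.2 hle, hper⟩
  refine ⟨l, r, t₀ + ε, t₀ + 1 - ε, hl, hr, hle, hb.injOn_Icc (by linarith), ?_, ?_, ?_, ?_⟩
  · rw [← himg, hb.range_eq (t₀ - ε), ← image_union]
    refine subset_antisymm (image_mono fun t ht => ?_) ?_
    · rcases le_total t (t₀ + ε) with h | h
      · exact .inl ⟨ht.1, h⟩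
      · exact .inr ⟨h, by linarith [ht.2]⟩
    · rw [← hb.range_eq]; exact image_subset_range _ _
  · rcases hends with ⟨h1, h2⟩ | ⟨h1, h2⟩ <;> rw [h1] <;> assumption
  · rcases hends with ⟨h1, h2⟩ | ⟨h1, h2⟩ <;> rw [h2] <;> assumption
  · rintro x hx ⟨t', ht', hxt'⟩
    have hxA : φ (x, 0) ∈ b '' Icc (t₀ - ε) (t₀ + ε) := by
      rw [himg]; exact ⟨x, Ioo_subset_Icc_self hx, rfl⟩
    obtain ⟨t, ht, hxt⟩ := hxA
    have hno : ¬ (φ (x, 0) = b (t₀ - ε) ∨ φ (x, 0) = b (t₀ + ε)) := by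
      have h1 : φ (x, 0) ≠ φ (l, 0) := fun h => hx.1.ne' (Prod.ext_iff.1 (hinj h)).1
      have h2 : φ (x, 0) ≠ φ (r, 0) := fun h => hx.2.ne (Prod.ext_iff.1 (hinj h)).1
      rcases hends with ⟨e1, e2⟩ | ⟨e1, e2⟩ <;> rw [← e1, ← e2] <;> tauto
    apply hno
    rcases eq_or_lt_of_le ht.1 with h | h
    · left; rw [← hxt, h]
    rcases eq_or_lt_of_le ht.2 with h' | h'
    · right; rw [← hxt, h']
    exact (hb.ne_of_lt (h'.trans_le ht'.1) (by linarith [ht'.2]) (hxt.trans hxt'.symm)).elim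

/-- The two sides of a closed curve at a flat point are separated by the curve. -/
lemma IsFlatChart.not_joinedOff {b : ℝ → ℝ × ℝ} (hb : IsLoop b) {t₀ : ℝ} {φ : ℝ × ℝ → ℝ × ℝ}
    (hφ : IsFlatChart (range b) (b t₀) φ) :
    ¬ JoinedOff (range b) (φ (0, 1)) (φ (0, -1)) := by
  intro hJ
  obtain ⟨l, r, s, t, hl, hr, hst, hinjst, hdec, hlB, hrB, hB⟩ := hφ.exists_decomposition hb
  have hinj := hφ.isOpenEmbedding.injective
  have hcont := hφ.isOpenEmbedding.continuous
  set A := (fun x => φ (x, 0)) '' Icc l r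
  set B := b '' Icc s t
  set A₁ : Set (ℝ × ℝ) := (Icc l r ×ˢ Icc 0 2) ∩ {q | q.1 = l ∨ q.1 = r ∨ q.2 = 2}
  have hA₁ : IsCompact A₁ := by
    refine (isCompact_Icc.prod isCompact_Icc).inter_right ?_
    exact (isClosed_eq continuous_fst continuous_const).union
      ((isClosed_eq continuous_fst continuous_const).union
        (isClosed_eq continuous_snd continuous_const))
  have hAc : IsCompact A := isCompact_Icc.image (by fun_prop)
  have hBc : IsCompact B := isCompact_Icc.image hb.continuous
  have hBp : IsPreconnected B := isPreconnected_Icc.image _ hb.continuous.continuousOn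
  have hAA₁ : A ∩ φ '' A₁ ⊆ B := by
    rintro _ ⟨⟨x, hx, rfl⟩, q, hq, hqx⟩
    have hqx := hinj hqx
    subst hqx
    obtain ⟨-, h | h | h⟩ := hq
    · simp only at h; subst h; exact hlB
    · simp only at h; subst h; exact hrB
    · norm_num at h
  have h2 : JoinedOff (φ '' A₁ ∪ B) (φ (0, 1)) (φ (0, -1)) := by
    refine ⟨φ '' ({0} ×ˢ Icc (-1) 1), (isPreconnected_singleton.prod isPreconnected_Icc).image _
      hcont.continuousOn, ?_, mem_image_of_mem _ (by simp), mem_image_of_mem _ (by simp)⟩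
    rw [disjoint_union_right]
    constructor
    · rw [disjoint_image_iff hinj, disjoint_left]
      rintro ⟨x, y⟩ ⟨hx, hy⟩ ⟨-, h⟩
      simp only [mem_singleton_iff, mem_Icc, mem_ofPred_eq] at hx hy h
      subst hx
      rcases h with h | h | h
      · exact hl.ne' h
      · exact hr.ne h
      · linarith [hy.2]
    · rw [disjoint_left]
      rintro _ ⟨⟨x, y⟩, ⟨hx, hy⟩, rfl⟩ hxy
      simp only [mem_singleton_iff] at hx
      subst hx
      have h0 : y = 0 := (hφ.mem_iff _).1 (image_subset_range b (Icc s t) hxy)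
      subst h0
      exact hB 0 ⟨hl, hr⟩ hxy
  have h3 := JoinedOff.theta hAc (hA₁.image hcont) hBc hBp hAA₁ (hdec ▸ hJ) h2
  obtain ⟨S, hS, hSd, hp, hq⟩ := h3
  have hW : IsOpen (φ '' (Ioo l r ×ˢ Ioo 0 2)) :=
    hφ.isOpenEmbedding.isOpenMap _ (isOpen_Ioo.prod isOpen_Ioo)
  have hW' : IsOpen (φ '' (Icc l r ×ˢ Icc 0 2))ᶜ :=
    ((isCompact_Icc.prod isCompact_Icc).image hcont).isClosed.isOpen_compl
  have hsub : S ⊆ φ '' (Ioo l r ×ˢ Ioo 0 2) ∪ (φ '' (Icc l r ×ˢ Icc 0 2))ᶜ := by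
    intro z hz
    by_cases hzR : z ∈ φ '' (Icc l r ×ˢ Icc 0 2)
    · left
      obtain ⟨⟨x, y⟩, ⟨hx, hy⟩, rfl⟩ := hzR
      have hno := disjoint_left.1 hSd hz
      simp only [mem_union, not_or] at hno
      have h1 : (x, y) ∉ A₁ := fun h => hno.2 (mem_image_of_mem _ h)
      have h2 : y ≠ 0 := by
        rintro rfl
        exact hno.1 ⟨x, hx, rfl⟩
      have h3 : ¬ (x = l ∨ x = r ∨ y = 2) := fun h => h1 ⟨⟨hx, hy⟩, h⟩
      push Not at h3
      exact ⟨(x, y), ⟨⟨lt_of_le_of_ne hx.1 h3.1.symm, lt_of_le_of_ne hx.2 h3.2.1⟩,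
        ⟨lt_of_le_of_ne hy.1 h2.symm, lt_of_le_of_ne hy.2 h3.2.2⟩⟩, rfl⟩
    · exact .inr hzR
  have hdis : Disjoint (φ '' (Ioo l r ×ˢ Ioo 0 2)) (φ '' (Icc l r ×ˢ Icc 0 2))ᶜ :=
    disjoint_compl_right_iff_subset.2
      (image_mono (prod_mono Ioo_subset_Icc_self Ioo_subset_Icc_self))
  have hall := hS.subset_left_of_subset_union hW hW' hdis hsub
    ⟨_, hp, mem_image_of_mem _ ⟨⟨hl, hr⟩, by norm_num⟩⟩
  obtain ⟨⟨x, y⟩, ⟨-, hy⟩, hxy⟩ := hall hq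
  have := (Prod.ext_iff.1 (hinj hxy)).2
  simp only [mem_Ioo] at hy this
  linarith [hy.1]

lemma IsFlatChart.joinedOff_of_mul_pos {β : Set (ℝ × ℝ)} {z : ℝ × ℝ} {φ : ℝ × ℝ → ℝ × ℝ}
    (hφ : IsFlatChart β z φ) {q q' : ℝ × ℝ} (h : 0 < q.2 * q'.2) :
    JoinedOff β (φ q) (φ q') := by
  refine ⟨φ '' segment ℝ q q', ((convex_segment q q').isPreconnected).image _
    hφ.isOpenEmbedding.continuous.continuousOn, ?_, mem_image_of_mem _ (left_mem_segment _ _ _),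
    mem_image_of_mem _ (right_mem_segment _ _ _)⟩
  rw [disjoint_left]
  rintro _ ⟨_, ⟨u, v, hu, hv, huv, rfl⟩, rfl⟩ hmem
  have h0 := (hφ.mem_iff _).1 hmem
  simp only [Prod.snd_add, Prod.smul_snd, smul_eq_mul] at h0
  have hv1 : v = 1 - u := by linarith
  subst hv1
  rcases mul_pos_iff.1 h with ⟨h1, h2⟩ | ⟨h1, h2⟩ <;> rcases hu.eq_or_lt with h3 | h3
  · subst h3; linarith
  · nlinarith [mul_pos h3 h1, mul_nonneg hv h2.le]
  · subst h3; linarith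
  · nlinarith [mul_neg_of_pos_of_neg h3 h1, mul_nonneg hv (neg_pos.2 h2).le]

/-- Every point off a closed curve can be joined to one of the sides at a given flat point. -/
lemma IsFlatChart.joinedOff_or {b : ℝ → ℝ × ℝ} (hb : IsLoop b) {t₀ : ℝ} {φ : ℝ × ℝ → ℝ × ℝ}
    (hφ : IsFlatChart (range b) (b t₀) φ) {p : ℝ × ℝ} (hp : p ∉ range b) :
    JoinedOff (range b) p (φ (0, 1)) ∨ JoinedOff (range b) p (φ (0, -1)) := by
  obtain ⟨l, r, s, t, hl, hr, hst, hinjst, hdec, hlB, hrB, hB⟩ := hφ.exists_decomposition hb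
  have hinj := hφ.isOpenEmbedding.injective
  have hβ : IsClosed (range b) := by
    rw [hdec]
    exact ((isCompact_Icc.image (by have := hφ.isOpenEmbedding.continuous; fun_prop)).union
      (isCompact_Icc.image hb.continuous)).isClosed
  by_contra! hno
  set V := connectedComponentIn (range b)ᶜ p
  have hVo : IsOpen V := hβ.isOpen_compl.connectedComponentIn
  have hVβ : V ⊆ (range b)ᶜ := connectedComponentIn_subset _ _
  have hpV : p ∈ V := mem_connectedComponentIn hp
  have hVJ : ∀ x ∈ V, JoinedOff (range b) p x := fun x hx =>
    ⟨V, isPreconnected_connectedComponentIn, disjoint_left.2 fun x hx => hVβ hx, hpV, hx⟩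
  have hVφ : ∀ q, φ q ∉ V := by
    intro q hq
    have hq2 : q.2 ≠ 0 := fun h => hVβ hq ((hφ.mem_iff q).2 h)
    rcases lt_or_gt_of_ne hq2 with h | h
    · exact hno.2 ((hVJ _ hq).trans (hφ.joinedOff_of_mul_pos (by simpa using h)))
    · exact hno.1 ((hVJ _ hq).trans (hφ.joinedOff_of_mul_pos (by simpa using h)))
  have hz : φ (0, 0) ∉ b '' Icc s t := hB 0 ⟨hl, hr⟩
  obtain ⟨S, hS, hSd, hpS, hzS⟩ := joinedOff_arc hb.continuous hst hinjst
    (fun h => hp (image_subset_range _ _ h)) hz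
  have hclV : ∀ x ∈ closure V, x ∈ S → x ∈ V := by
    intro x hx hxS
    have hxφ : x ∉ range φ := by
      intro hxφ
      obtain ⟨_, ⟨q, rfl⟩, hy⟩ := mem_closure_iff.1 hx _ hφ.isOpenEmbedding.isOpen_range hxφ
      exact hVφ q hy
    have hxβ : x ∉ range b := by
      intro hxβ
      rw [hdec] at hxβ
      rcases hxβ with ⟨u, -, rfl⟩ | h
      · exact hxφ ⟨_, rfl⟩
      · exact disjoint_left.1 hSd hxS h
    have hUo : IsOpen (connectedComponentIn (range b)ᶜ x) :=
      hβ.isOpen_compl.connectedComponentIn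
    obtain ⟨y, hy1, hy2⟩ := mem_closure_iff.1 hx _ hUo (mem_connectedComponentIn hxβ)
    have e1 := connectedComponentIn_eq hy1
    have e2 := connectedComponentIn_eq hy2
    change x ∈ connectedComponentIn _ p
    rw [e2, ← e1]
    exact mem_connectedComponentIn hxβ
  have hsub : S ⊆ V ∪ (closure V)ᶜ := fun x hx => by
    by_cases h : x ∈ closure V
    · exact .inl (hclV x h hx)
    · exact .inr h
  have := hS.subset_left_of_subset_union hVo isClosed_closure.isOpen_compl
    (disjoint_compl_right_iff_subset.2 subset_closure) hsub ⟨p, hpS, hpV⟩ hzS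
  exact hVφ _ this

/-- Crosscuts of a closed curve with interlaced endpoints lie on different sides. -/
lemma IsLoop.not_joinedOff_of_interlaced {b : ℝ → ℝ × ℝ} (hb : IsLoop b) {x y z w : ℝ}
    {φ : ℝ × ℝ → ℝ × ℝ} (hφ : IsFlatChart (range b) (b x) φ) (hxz : x < z) (hzy : z < y)
    (hyw : y < w) (hwx : w < x + 1) {γ G : Set (ℝ × ℝ)} (hγ : IsCompact γ)
    (hγp : IsPreconnected γ) (hγb : γ ∩ range b = {b x, b y})
    (hγ' : IsPreconnected (γ \ range b)) (hcl : b x ∈ closure (γ \ range b))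
    (hG : IsPreconnected G) (hGγ : Disjoint G γ) (hGb : Disjoint G (range b))
    (hGz : b z ∈ closure G) (hGw : b w ∈ closure G) {p q : ℝ × ℝ} (hp : p ∈ γ \ range b)
    (hq : q ∈ G) : ¬ JoinedOff (range b) p q := by
  wlog hup : ∃ v : ℝ × ℝ, 0 < v.2 ∧ φ v ∈ γ \ range b generalizing φ
  · refine this hφ.flip ?_
    obtain ⟨_, ⟨v, rfl⟩, hv⟩ := mem_closure_iff.1 hcl _ hφ.isOpenEmbedding.isOpen_range
      ⟨_, hφ.map_zero⟩
    have hv0 : v.2 ≠ 0 := fun h => hv.2 ((hφ.mem_iff v).2 h)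
    have hv1 : ¬ 0 < v.2 := fun h => hup ⟨v, h, hv⟩
    exact ⟨(v.1, -v.2), by simpa using lt_of_le_of_ne (not_lt.1 hv1) hv0, by simpa using hv⟩
  obtain ⟨v, hv, hvγ⟩ := hup
  have hγJ : ∀ u ∈ γ \ range b, JoinedOff (range b) u (φ (0, 1)) := fun u hu =>
    JoinedOff.trans ⟨_, hγ', disjoint_sdiff_left, hu, hvγ⟩
      (hφ.joinedOff_of_mul_pos (by simpa using hv))
  have hlow : ∀ u : ℝ × ℝ, u.2 < 0 → φ u ∉ γ := by
    intro u hu huγ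
    have hub : φ u ∉ range b := fun h => hu.ne ((hφ.mem_iff u).1 h)
    exact hφ.not_joinedOff hb ((hγJ _ ⟨huγ, hub⟩).symm.trans
      (hφ.joinedOff_of_mul_pos (by simpa using hu)))
  have key : ∀ I J : Set ℝ, IsPreconnected I → Disjoint (b '' I) (b '' J ∪ γ) →
      ∀ c : ℝ, φ (c, 0) ∈ b '' I → ∀ k ∈ I, b k ∈ closure G →
      JoinedOff (b '' J ∪ γ) q (φ (0, -1)) := by
    intro I J hI hIJ c hc k hk hkG
    have h1 : JoinedOff (b '' J ∪ γ) q (b k) := by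
      refine ⟨insert (b k) G, hG.subset_closure (subset_insert _ _)
        (insert_subset hkG subset_closure), ?_, mem_insert_of_mem _ hq, mem_insert _ _⟩
      rw [← singleton_union, disjoint_union_left]
      refine ⟨hIJ.mono_left (by simpa using mem_image_of_mem b hk), ?_⟩
      rw [disjoint_union_right]
      exact ⟨hGb.mono_right (image_subset_range _ _), hGγ⟩
    have h2 : JoinedOff (b '' J ∪ γ) (b k) (φ (c, 0)) :=
      ⟨b '' I, hI.image _ hb.continuous.continuousOn, hIJ, mem_image_of_mem _ hk, hc⟩
    have h3 : JoinedOff (b '' J ∪ γ) (φ (c, 0)) (φ (0, -1)) := by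
      have hcont := hφ.isOpenEmbedding.continuous
      refine ⟨(fun s : ℝ => φ ((1 - s) * c, -s)) '' Icc 0 1, isPreconnected_Icc.image _
        (Continuous.continuousOn (by fun_prop)), ?_, ⟨0, by simp⟩, ⟨1, by simp⟩⟩
      rw [disjoint_left]
      rintro _ ⟨s, hs, rfl⟩ hmem
      rcases eq_or_lt_of_le hs.1 with h | h
      · subst h
        exact disjoint_left.1 hIJ hc (by simpa using hmem)
      · rcases hmem with hm | hm
        · have := (hφ.mem_iff _).1 (image_subset_range _ _ hm)
          simp only at this
          linarith
        · exact hlow _ (by simpa using h) hm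
    exact (h1.trans h2).trans h3
  have hopen : b ⁻¹' range φ ∈ 𝓝 x :=
    (hφ.isOpenEmbedding.isOpen_range.preimage hb.continuous).mem_nhds ⟨_, hφ.map_zero⟩
  obtain ⟨η, hη, hball⟩ := Metric.mem_nhds_iff.1 hopen
  have hpt : ∀ t, |t - x| < η → ∃ c, φ (c, 0) = b t := by
    intro t ht
    obtain ⟨⟨c, d⟩, hcd⟩ := hball (by simpa [Real.dist_eq] using ht : t ∈ Metric.ball x η)
    have : d = 0 := (hφ.mem_iff (c, d)).1 (hcd ▸ mem_range_self t)
    subst this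
    exact ⟨c, hcd⟩
  obtain ⟨ε, hε, hεm⟩ := exists_between (lt_min hη
    (lt_min (by linarith : 0 < y - x) (by linarith : 0 < x + 1 - y)))
  have hεη : ε < η := hεm.trans_le (min_le_left _ _)
  have hε1 : ε < y - x := hεm.trans_le ((min_le_right _ _).trans (min_le_left _ _))
  have hε2 : ε < x + 1 - y := hεm.trans_le ((min_le_right _ _).trans (min_le_right _ _))
  have hdγ : ∀ I : Set ℝ, (∀ t ∈ I, b t ≠ b x ∧ b t ≠ b y) → Disjoint (b '' I) γ := by
    intro I hI
    rw [disjoint_left]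
    rintro _ ⟨t, ht, rfl⟩ htγ
    have : b t ∈ γ ∩ range b := ⟨htγ, mem_range_self t⟩
    rw [hγb] at this
    rcases this with h | h
    · exact (hI t ht).1 h
    · exact (hI t ht).2 h
  have k1 : JoinedOff (b '' Icc x y ∪ γ) q (φ (0, -1)) := by
    obtain ⟨c, hc⟩ := hpt (x - ε) (by simpa [abs_of_pos hε] using hεη)
    refine key (Ioo y (x + 1)) (Icc x y) isPreconnected_Ioo ?_ c ?_ w ⟨hyw, hwx⟩ hGw
    · rw [disjoint_union_right]
      refine ⟨?_, hdγ _ fun t ht => ⟨?_, ?_⟩⟩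
      · rw [disjoint_left]
        rintro _ ⟨t, ht, rfl⟩ ⟨t', ht', h⟩
        exact hb.ne_of_lt (ht'.2.trans_lt ht.1) (by linarith [ht.2, ht'.1]) h
      · exact (hb.ne_of_lt (by linarith [ht.1]) ht.2).symm
      · exact (hb.ne_of_lt ht.1 (by linarith [ht.2])).symm
    · exact ⟨x - ε + 1, ⟨by linarith, by linarith⟩, by rw [hb.add_one, hc]⟩
  have k2 : JoinedOff (b '' Icc y (x + 1) ∪ γ) q (φ (0, -1)) := by
    obtain ⟨c, hc⟩ := hpt (x + ε) (by simpa [abs_of_pos hε] using hεη)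
    refine key (Ioo x y) (Icc y (x + 1)) isPreconnected_Ioo ?_ c ?_ z ⟨hxz, hzy⟩ hGz
    · rw [disjoint_union_right]
      refine ⟨?_, hdγ _ fun t ht => ⟨?_, ?_⟩⟩
      · rw [disjoint_left]
        rintro _ ⟨t, ht, rfl⟩ ⟨t', ht', h⟩
        exact hb.ne_of_lt (ht.2.trans_le ht'.1) (by linarith [ht.1, ht'.2]) h.symm
      · exact (hb.ne_of_lt ht.1 (by linarith [ht.2])).symm
      · exact hb.ne_of_lt ht.2 (by linarith [ht.1])
    · exact ⟨x + ε, ⟨by linarith, by linarith⟩, hc.symm⟩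
  have hcov : range b = b '' Icc x y ∪ b '' Icc y (x + 1) := by
    refine subset_antisymm ?_ (union_subset (image_subset_range _ _) (image_subset_range _ _))
    rw [hb.range_eq x, ← image_union, Icc_union_Icc_eq_Icc (by linarith) (by linarith)]
    exact image_mono Ico_subset_Icc_self
  have hint : b '' Icc x y ∩ b '' Icc y (x + 1) ⊆ γ := by
    rintro _ ⟨⟨t, ht, rfl⟩, ⟨t', ht', h⟩⟩
    have hmem : ∀ u ∈ ({b x, b y} : Set (ℝ × ℝ)), u ∈ γ := fun u hu => (hγb ▸ hu : u ∈ γ ∩ _).1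
    rcases eq_or_lt_of_le ht.1 with h1 | h1
    · exact hmem _ (by simp [h1])
    rcases eq_or_lt_of_le ht.2 with h2 | h2
    · exact hmem _ (by simp [h2])
    exact (hb.ne_of_lt (h2.trans_le ht'.1) (by linarith [ht'.2]) h.symm).elim
  have hqe := JoinedOff.theta (isCompact_Icc.image hb.continuous)
    (isCompact_Icc.image hb.continuous) hγ hγp hint k1 k2
  rw [← hcov] at hqe
  intro hJ
  exact hφ.not_joinedOff hb ((hγJ p hp).symm.trans (hJ.trans hqe))

/-- The unit circle in the plane, parametrised with period one. -/
noncomputable def circlePoint (t : ℝ) : Metric.sphere (0 : EuclideanSpace ℝ (Fin 2)) 1 :=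
  ⟨!₂[Real.cos (2 * Real.pi * t), Real.sin (2 * Real.pi * t)], by
    simp [EuclideanSpace.norm_eq, Fin.sum_univ_two]⟩

lemma continuous_circlePoint : Continuous circlePoint := by
  refine Continuous.subtype_mk ?_ _
  refine (PiLp.continuous_toLp 2 _).comp (continuous_pi fun i => ?_)
  fin_cases i <;> simp <;> fun_prop

lemma circlePoint_eq_iff (s t : ℝ) :
    circlePoint s = circlePoint t ↔ ∃ n : ℤ, s = t + n := by
  constructor
  · intro h
    have h0 := congrArg (fun x => x.1 0) h
    have h1 := congrArg (fun x => x.1 1) h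
    simp only [circlePoint, Matrix.cons_val_zero, Matrix.cons_val_one,
      PiLp.toLp_apply] at h0 h1
    obtain ⟨k, hk⟩ := Real.Angle.angle_eq_iff_two_pi_dvd_sub.1 (Real.Angle.cos_sin_inj h0 h1)
    refine ⟨k, ?_⟩
    have := Real.pi_pos
    have h2 : 2 * Real.pi * (s - (t + k)) = 0 := by linear_combination hk
    rcases mul_eq_zero.1 h2 with h3 | h3 <;> linarith
  · rintro ⟨n, rfl⟩
    have : 2 * Real.pi * (t + n) = 2 * Real.pi * t + n * (2 * Real.pi) := by ring
    simp [circlePoint, this, Real.cos_add_int_mul_two_pi, Real.sin_add_int_mul_two_pi]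

lemma surjective_circlePoint : Function.Surjective circlePoint := by
  rintro ⟨p, hp⟩
  have hp2 : (p 0) ^ 2 + (p 1) ^ 2 = 1 := by
    simpa [EuclideanSpace.norm_eq, Fin.sum_univ_two] using hp
  have hz : ‖(⟨p 0, p 1⟩ : ℂ)‖ = 1 := by
    rw [Complex.norm_eq_sqrt_sq_add_sq, hp2, Real.sqrt_one]
  have hne : (⟨p 0, p 1⟩ : ℂ) ≠ 0 := by
    intro h; rw [h] at hz; simp at hz
  refine ⟨Complex.arg ⟨p 0, p 1⟩ / (2 * Real.pi), Subtype.ext ?_⟩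
  have h2 : 2 * Real.pi * (Complex.arg ⟨p 0, p 1⟩ / (2 * Real.pi)) = Complex.arg ⟨p 0, p 1⟩ := by
    field_simp
  ext i
  fin_cases i
  · simp [circlePoint, h2, Complex.cos_arg hne, hz]
  · simp [circlePoint, h2, Complex.sin_arg, hz]

lemma IsSimpleClosedCurve.exists_isLoop {c : Set (ℝ × ℝ)} (h : IsSimpleClosedCurve c) :
    ∃ b, IsLoop b ∧ range b = c := by
  obtain ⟨e⟩ := h
  refine ⟨fun t => e.symm (circlePoint t), ⟨?_, fun s t => ?_⟩, ?_⟩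
  · have := continuous_circlePoint
    fun_prop
  · rw [← circlePoint_eq_iff, Subtype.coe_inj, e.symm.injective.eq_iff]
  · have : (fun t => (e.symm (circlePoint t) : ℝ × ℝ)) =
        Subtype.val ∘ (e.symm ∘ circlePoint) := rfl
    rw [this, range_comp, (e.symm.surjective.comp surjective_circlePoint).range_eq]
    simp

/-- `b` and `r` are simple closed parametrisations meeting only in crossings. -/
structure IsCrossingPair (b r : ℝ → ℝ × ℝ) : Prop where
  left : IsLoop b
  right : IsLoop r
  exists_chart : ∀ z ∈ range b ∩ range r, ∃ φ : ℝ × ℝ → ℝ × ℝ,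
    IsFlatChart (range b) z φ ∧ IsFlatChart (range r) z (φ ∘ Prod.swap)

lemma IsCrossing.exists_chart {β ρ : Set (ℝ × ℝ)} {z : ℝ × ℝ} (h : IsCrossing β ρ z) :
    ∃ φ : ℝ × ℝ → ℝ × ℝ, IsFlatChart β z φ ∧ IsFlatChart ρ z (φ ∘ Prod.swap) := by
  obtain ⟨U, hU, hz, h, h0, hβ, hρ⟩ := h
  have key : ∀ K : Set (ℝ × ℝ), ∀ q, (h.symm q : ℝ × ℝ) ∈ K ↔
      q ∈ ⇑h '' {p : U | (p : ℝ × ℝ) ∈ K} := by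
    intro K q
    constructor
    · intro hq
      exact ⟨h.symm q, hq, h.apply_symm_apply q⟩
    · rintro ⟨p, hp, rfl⟩
      simpa using hp
  have he : IsOpenEmbedding (fun q => (h.symm q : ℝ × ℝ)) :=
    hU.isOpenEmbedding_subtypeVal.comp h.symm.isOpenEmbedding
  have hz' : (h.symm (0, 0) : ℝ × ℝ) = z := by rw [← h0, h.symm_apply_apply]
  refine ⟨fun q => h.symm q, ⟨he, hz', fun q => ?_⟩,
    ⟨he.comp (Homeomorph.prodComm ℝ ℝ).isOpenEmbedding, hz', fun q => ?_⟩⟩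
  · rw [key, hβ]; rfl
  · show ((h.symm q.swap : ℝ × ℝ) ∈ ρ) ↔ _
    rw [key, hρ]; rfl

namespace IsCrossingPair

variable {b r : ℝ → ℝ × ℝ}

lemma symm (h : IsCrossingPair b r) : IsCrossingPair r b where
  left := h.right
  right := h.left
  exists_chart z hz := by
    obtain ⟨φ, h1, h2⟩ := h.exists_chart z hz.symm
    exact ⟨_, h2, h1⟩

lemma isCompact_range {b : ℝ → ℝ × ℝ} (hb : IsLoop b) : IsCompact (range b) := by
  have : range b = b '' Icc 0 1 := by
    refine subset_antisymm ?_ (image_subset_range _ _)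
    rw [hb.range_eq 0, zero_add]
    exact image_mono Ico_subset_Icc_self
  rw [this]
  exact isCompact_Icc.image hb.continuous

lemma finite_inter (h : IsCrossingPair b r) : (range b ∩ range r).Finite := by
  have hc : IsCompact (range b ∩ range r) :=
    (isCompact_range h.left).inter_right (isCompact_range h.right).isClosed
  refine hc.finite (isDiscrete_iff_discreteTopology.2 ?_)
  rw [discreteTopology_subtype_iff']
  intro z hz
  obtain ⟨φ, h1, h2⟩ := h.exists_chart z hz
  refine ⟨range φ, h1.isOpenEmbedding.isOpen_range, subset_antisymm ?_ ?_⟩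
  · rintro _ ⟨⟨q, rfl⟩, hq1, hq2⟩
    have e1 := (h1.mem_iff q).1 hq1
    have e2 := (h2.mem_iff q.swap).1 (by simpa using hq2)
    have : q = (0, 0) := Prod.ext e2 e1
    rw [this, h1.map_zero]; rfl
  · rintro _ rfl
    exact ⟨⟨_, h1.map_zero⟩, hz⟩

end IsCrossingPair

/-- The parameters `s < t` are consecutive visits of `r` to `K`. -/
structure IsEdge (r : ℝ → ℝ × ℝ) (K : Set (ℝ × ℝ)) (s t : ℝ) : Prop where
  lt : s < t
  left_mem : r s ∈ K
  right_mem : r t ∈ K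
  notMem : ∀ u ∈ Ioo s t, r u ∉ K

namespace IsCrossingPair

variable {b r : ℝ → ℝ × ℝ}

lemma finite_visits (h : IsCrossingPair b r) {S : Set ℝ}
    (hS : ∀ x ∈ S, ∀ y ∈ S, y < x + 1) : ({t | r t ∈ range b} ∩ S).Finite := by
  refine Finite.of_finite_image (f := r) (h.finite_inter.subset ?_) ?_
  · rintro _ ⟨t, ht, rfl⟩
    exact ⟨ht.1, mem_range_self t⟩
  · intro x hx y hy hxy
    rcases lt_trichotomy x y with hlt | heq | hlt
    · exact (h.right.ne_of_lt hlt (hS x hx.2 y hy.2) hxy).elim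
    · exact heq
    · exact (h.right.ne_of_lt hlt (hS y hy.2 x hx.2) hxy.symm).elim

lemma exists_next (h : IsCrossingPair b r) {s : ℝ} (hs : r s ∈ range b) :
    ∃ t, t ≤ s + 1 ∧ IsEdge r (range b) s t := by
  obtain ⟨t, ht, hmin⟩ := exists_min_image ({u | r u ∈ range b} ∩ Ioc s (s + 1)) id
    (h.finite_visits fun x hx y hy => by linarith [hx.1, hy.2])
    ⟨s + 1, by simpa [h.right.add_one s] using hs, by simp⟩
  refine ⟨t, ht.2.2, ht.2.1, hs, ht.1, fun u hu hub => ?_⟩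
  exact absurd (hmin u ⟨hub, hu.1, hu.2.le.trans ht.2.2⟩) (not_le.2 hu.2)

lemma exists_prev (h : IsCrossingPair b r) {t : ℝ} (ht : r t ∈ range b) :
    ∃ s, t ≤ s + 1 ∧ IsEdge r (range b) s t := by
  obtain ⟨s, hs, hmax⟩ := exists_max_image ({u | r u ∈ range b} ∩ Ico (t - 1) t) id
    (h.finite_visits fun x hx y hy => by linarith [hx.1, hy.2])
    ⟨t - 1, by simpa [h.right.sub_one t] using ht, by simp⟩
  refine ⟨s, by linarith [hs.2.1], hs.2.2, hs.1, ht, fun u hu hub => ?_⟩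
  exact absurd (hmax u ⟨hub, hs.2.1.trans hu.1.le, hu.2⟩) (not_le.2 hu.1)

end IsCrossingPair

namespace IsEdge

variable {r : ℝ → ℝ × ℝ} {K : Set (ℝ × ℝ)} {s t s' t' : ℝ}

lemma shift (hr : IsLoop r) (h : IsEdge r K s t) (n : ℤ) : IsEdge r K (s + n) (t + n) := by
  have hn : ∀ u, r (u + n) = r u := fun u => (hr.eq_iff _ _).2 ⟨n, rfl⟩
  refine ⟨by linarith [h.lt], by rw [hn]; exact h.left_mem, by rw [hn]; exact h.right_mem,
    fun u hu => ?_⟩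
  rw [← sub_add_cancel u (n : ℝ), hn]
  exact h.notMem _ ⟨by linarith [hu.1], by linarith [hu.2]⟩

lemma eq_of_overlap (h : IsEdge r K s t) (h' : IsEdge r K s' t') (h1 : s' < t) (h2 : s < t') :
    s = s' ∧ t = t' := by
  have e1 : s = s' := by
    rcases lt_trichotomy s s' with hlt | heq | hlt
    · exact (h.notMem s' ⟨hlt, h1⟩ h'.left_mem).elim
    · exact heq
    · exact (h'.notMem s ⟨hlt, h2⟩ h.left_mem).elim
  refine ⟨e1, ?_⟩
  have := h.lt
  have := h'.lt
  rcases lt_trichotomy t t' with hlt | heq | hlt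
  · exact (h'.notMem t ⟨by linarith, hlt⟩ h.right_mem).elim
  · exact heq
  · exact (h.notMem t' ⟨by linarith, hlt⟩ h'.right_mem).elim

lemma image_inter (h : IsEdge r K s t) : r '' Icc s t ∩ K = {r s, r t} := by
  refine subset_antisymm ?_ ?_
  · rintro _ ⟨⟨u, hu, rfl⟩, huK⟩
    rcases hu.1.eq_or_lt with h1 | h1
    · subst h1; exact .inl rfl
    rcases hu.2.eq_or_lt with h2 | h2
    · subst h2; exact .inr rfl
    exact (h.notMem u ⟨h1, h2⟩ huK).elim
  · rintro _ (rfl | rfl)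
    · exact ⟨mem_image_of_mem _ (left_mem_Icc.2 h.lt.le), h.left_mem⟩
    · exact ⟨mem_image_of_mem _ (right_mem_Icc.2 h.lt.le), h.right_mem⟩

lemma image_diff (h : IsEdge r K s t) : r '' Icc s t \ K = r '' Ioo s t := by
  refine subset_antisymm ?_ ?_
  · rintro _ ⟨⟨u, hu, rfl⟩, huK⟩
    refine mem_image_of_mem _ ⟨lt_of_le_of_ne hu.1 ?_, lt_of_le_of_ne hu.2 ?_⟩
    · rintro rfl; exact huK h.left_mem
    · rintro rfl; exact huK h.right_mem
  · rintro _ ⟨u, hu, rfl⟩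
    exact ⟨mem_image_of_mem _ (Ioo_subset_Icc_self hu), h.notMem u hu⟩

lemma mem_closure (hr : Continuous r) (h : IsEdge r K s t) :
    r s ∈ closure (r '' Ioo s t) ∧ r t ∈ closure (r '' Ioo s t) := by
  have := image_closure_subset_closure_image hr (s := Ioo s t)
  rw [closure_Ioo h.lt.ne] at this
  exact ⟨this (mem_image_of_mem _ (left_mem_Icc.2 h.lt.le)),
    this (mem_image_of_mem _ (right_mem_Icc.2 h.lt.le))⟩

lemma joinedOff (hr : Continuous r) (h : IsEdge r K s t) {u v : ℝ} (hu : u ∈ Ioo s t)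
    (hv : v ∈ Ioo s t) : JoinedOff K (r u) (r v) :=
  ⟨r '' Ioo s t, isPreconnected_Ioo.image _ hr.continuousOn,
    by rw [← h.image_diff]; exact disjoint_sdiff_left, mem_image_of_mem _ hu,
    mem_image_of_mem _ hv⟩

lemma midpoint_mem (h : IsEdge r K s t) : (s + t) / 2 ∈ Ioo s t :=
  ⟨by linarith [h.lt], by linarith [h.lt]⟩

end IsEdge

/-- The points off `K` at which `C` holds and those at which it fails are the two sides of `K`. -/
def IsTwoColoring {X : Type*} [TopologicalSpace X] (K : Set X) (C : X → Prop) : Prop :=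
  ∀ p q, p ∉ K → q ∉ K → (JoinedOff K p q ↔ (C p ↔ C q))

lemma IsTwoColoring.not {X : Type*} [TopologicalSpace X] {K : Set X} {C : X → Prop}
    (h : IsTwoColoring K C) : IsTwoColoring K fun p => ¬ C p := fun p q hp hq => by
  rw [h p q hp hq, not_iff_not]

/-- `x` and `y` are the ends of a piece of `r` whose interior is off `b` and coloured by `C`. -/
def IsMatched (b r : ℝ → ℝ × ℝ) (C : ℝ × ℝ → Prop) (x y : ℝ × ℝ) : Prop :=
  ∃ s t, IsEdge r (range b) s t ∧ (∀ u ∈ Ioo s t, C (r u)) ∧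
    (r s = x ∧ r t = y ∨ r s = y ∧ r t = x)

lemma IsMatched.symm {b r : ℝ → ℝ × ℝ} {C : ℝ × ℝ → Prop} {x y : ℝ × ℝ}
    (h : IsMatched b r C x y) : IsMatched b r C y x := by
  obtain ⟨s, t, he, hC, h⟩ := h
  exact ⟨s, t, he, hC, h.symm⟩

lemma IsMatched.left_mem {b r : ℝ → ℝ × ℝ} {C : ℝ × ℝ → Prop} {x y : ℝ × ℝ}
    (h : IsMatched b r C x y) : x ∈ range b ∩ range r := by
  obtain ⟨s, t, he, hC, ⟨rfl, rfl⟩ | ⟨rfl, rfl⟩⟩ := h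
  · exact ⟨he.left_mem, mem_range_self _⟩
  · exact ⟨he.right_mem, mem_range_self _⟩

namespace IsCrossingPair

variable {b r : ℝ → ℝ × ℝ} {C : ℝ × ℝ → Prop}

lemma exists_isTwoColoring (h : IsCrossingPair b r) (hne : (range b ∩ range r).Nonempty) :
    ∃ C, IsTwoColoring (range b) C := by
  obtain ⟨z, hz⟩ := hne
  obtain ⟨φ, hφ, -⟩ := h.exists_chart z hz
  obtain ⟨t, rfl⟩ := hz.1
  refine ⟨fun p => JoinedOff (range b) p (φ (0, 1)), fun p q hp hq => ⟨fun hpq =>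
    ⟨fun h' => hpq.symm.trans h', fun h' => hpq.trans h'⟩, fun hpq => ?_⟩⟩
  by_cases hp1 : JoinedOff (range b) p (φ (0, 1))
  · exact hp1.trans (hpq.1 hp1).symm
  · have hp2 := (hφ.joinedOff_or h.left hp).resolve_left hp1
    have hq2 := (hφ.joinedOff_or h.left hq).resolve_left fun h' => hp1 (hpq.2 h')
    exact hp2.trans hq2.symm

/-- Consecutive pieces of `r` lie on different sides of `b`. -/
lemma not_joinedOff_of_isEdge (h : IsCrossingPair b r) {s t w u v : ℝ}
    (h1 : IsEdge r (range b) s t) (h2 : IsEdge r (range b) t w) (hu : u ∈ Ioo s t)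
    (hv : v ∈ Ioo t w) : ¬ JoinedOff (range b) (r u) (r v) := by
  obtain ⟨t₀, ht₀⟩ := h1.right_mem
  obtain ⟨φ, hφ, hψ⟩ := h.exists_chart (r t) ⟨h1.right_mem, mem_range_self t⟩
  obtain ⟨ε, hε, hεδ, l, m, hl, hm, -, hends⟩ := hψ.exists_param h.right
    (lt_min (sub_pos.2 h1.lt) (sub_pos.2 h2.lt))
  rw [← ht₀] at hφ
  rw [lt_min_iff] at hεδ
  simp only [Function.comp_apply, Prod.swap_prod_mk] at hends
  intro hJ
  have hJ' : JoinedOff (range b) (r (t - ε)) (r (t + ε)) :=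
    ((h1.joinedOff h.right.continuous ⟨by linarith, by linarith⟩ hu).trans hJ).trans
      (h2.joinedOff h.right.continuous hv ⟨by linarith, by linarith⟩)
  have hlm : JoinedOff (range b) (φ (0, m)) (φ (0, l)) := by
    rcases hends with ⟨e1, e2⟩ | ⟨e1, e2⟩
    · rw [e1, e2]; exact hJ'.symm
    · rw [e1, e2]; exact hJ'
  refine hφ.not_joinedOff h.left (((hφ.joinedOff_of_mul_pos ?_).trans hlm).trans
    (hφ.joinedOff_of_mul_pos ?_)) <;> simp [hl, hm]

lemma lt_add_one_of_isEdge (h : IsCrossingPair b r) {s t : ℝ} (he : IsEdge r (range b) s t) :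
    t < s + 1 := by
  have he1 : IsEdge r (range b) (s + 1) (t + 1) := by simpa using he.shift h.right 1
  by_contra! hle
  rcases hle.eq_or_lt with heq | hlt
  · rw [heq] at he1
    have hmid := he.midpoint_mem
    refine h.not_joinedOff_of_isEdge he he1 hmid (v := (s + t) / 2 + 1)
      ⟨by linarith [hmid.1], by linarith [hmid.2]⟩ ?_
    rw [h.right.add_one]
    exact he.joinedOff h.right.continuous hmid hmid
  · exact he.notMem _ ⟨by linarith, hlt⟩ he1.left_mem

lemma isMatched_ne (h : IsCrossingPair b r) {x y : ℝ × ℝ} (hxy : IsMatched b r C x y) :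
    x ≠ y := by
  obtain ⟨s, t, he, -, hst⟩ := hxy
  have := h.right.ne_of_lt he.lt (h.lt_add_one_of_isEdge he)
  rcases hst with ⟨rfl, rfl⟩ | ⟨rfl, rfl⟩
  exacts [this, this.symm]

lemma exists_isMatched (h : IsCrossingPair b r) (hC : IsTwoColoring (range b) C) {x : ℝ × ℝ}
    (hx : x ∈ range b ∩ range r) : ∃ y, IsMatched b r C x y := by
  obtain ⟨hxb, t, rfl⟩ := hx
  obtain ⟨w, -, hw⟩ := h.exists_next hxb
  obtain ⟨s, -, hs⟩ := h.exists_prev hxb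
  have hspread : ∀ {s t}, IsEdge r (range b) s t → C (r ((s + t) / 2)) →
      ∀ u ∈ Ioo s t, C (r u) := fun he hc u hu =>
    ((hC _ _ (he.notMem _ he.midpoint_mem) (he.notMem u hu)).1
      (he.joinedOff h.right.continuous he.midpoint_mem hu)).1 hc
  by_cases hc : C (r ((t + w) / 2))
  · exact ⟨_, t, w, hw, hspread hw hc, .inl ⟨rfl, rfl⟩⟩
  · have hno := h.not_joinedOff_of_isEdge hs hw hs.midpoint_mem hw.midpoint_mem
    rw [hC _ _ (hs.notMem _ hs.midpoint_mem) (hw.notMem _ hw.midpoint_mem)] at hno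
    exact ⟨_, s, t, hs, hspread hs (by tauto), .inr ⟨rfl, rfl⟩⟩

lemma isMatched_unique (h : IsCrossingPair b r) (hC : IsTwoColoring (range b) C)
    {x y y' : ℝ × ℝ} (hy : IsMatched b r C x y) (hy' : IsMatched b r C x y') : y = y' := by
  have hmix : ∀ {s t s' t'}, IsEdge r (range b) s t → IsEdge r (range b) s' t' →
      (∀ u ∈ Ioo s t, C (r u)) → (∀ u ∈ Ioo s' t', C (r u)) → r s ≠ r t' := by
    intro s t s' t' he he' hc hc' heq
    obtain ⟨n, rfl⟩ := (h.right.eq_iff _ _).1 heq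
    have he2 := he'.shift h.right n
    refine h.not_joinedOff_of_isEdge he2 he he2.midpoint_mem he.midpoint_mem ?_
    rw [hC _ _ (he2.notMem _ he2.midpoint_mem) (he.notMem _ he.midpoint_mem)]
    have e : r ((s' + n + (t' + n)) / 2) = r ((s' + t') / 2) :=
      (h.right.eq_iff _ _).2 ⟨n, by ring⟩
    rw [e]
    exact iff_of_true (hc' _ he'.midpoint_mem) (hc _ he.midpoint_mem)
  obtain ⟨s, t, he, hc, hst⟩ := hy
  obtain ⟨s', t', he', hc', hst'⟩ := hy'
  rcases hst with ⟨e1, e2⟩ | ⟨e1, e2⟩ <;> rcases hst' with ⟨e3, e4⟩ | ⟨e3, e4⟩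
  · obtain ⟨n, rfl⟩ := (h.right.eq_iff _ _).1 (e1.trans e3.symm)
    have := he.lt
    have := he'.lt
    have h2 := (he.eq_of_overlap (he'.shift h.right n) (by linarith) (by linarith)).2
    rw [← e2, ← e4, h.right.eq_iff]
    exact ⟨n, h2⟩
  · exact (hmix he he' hc hc' (e1.trans e4.symm)).elim
  · exact (hmix he' he hc' hc (e3.trans e2.symm)).elim
  · obtain ⟨n, rfl⟩ := (h.right.eq_iff _ _).1 (e2.trans e4.symm)
    have := he.lt
    have := he'.lt
    have h2 := (he.eq_of_overlap (he'.shift h.right n) (by linarith) (by linarith)).1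
    rw [← e1, ← e3, h.right.eq_iff]
    exact ⟨n, h2⟩

lemma isMatched_not_interlaced (h : IsCrossingPair b r) (hC : IsTwoColoring (range b) C)
    {x y z w : ℝ} (hxz : x < z) (hzy : z < y) (hyw : y < w) (hwx : w < x + 1)
    (hxy : IsMatched b r C (b x) (b y)) (hzw : IsMatched b r C (b z) (b w)) : False := by
  obtain ⟨φ, hφ, -⟩ := h.exists_chart _ hxy.left_mem
  obtain ⟨s, t, he, hc, hst⟩ := hxy
  obtain ⟨s', t', he', hc', hst'⟩ := hzw
  have hr := h.right.continuous
  have hp := he.midpoint_mem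
  have hq := he'.midpoint_mem
  refine h.left.not_joinedOff_of_interlaced hφ hxz hzy hyw hwx (γ := r '' Icc s t)
    (G := r '' Ioo s' t') (isCompact_Icc.image hr) (isPreconnected_Icc.image _ hr.continuousOn)
    ?_ ?_ ?_ (isPreconnected_Ioo.image _ hr.continuousOn) ?_ ?_ ?_ ?_ (p := r ((s + t) / 2))
    ⟨mem_image_of_mem _ (Ioo_subset_Icc_self hp), he.notMem _ hp⟩ (mem_image_of_mem _ hq)
    ((hC _ _ (he.notMem _ hp) (he'.notMem _ hq)).2 (iff_of_true (hc _ hp) (hc' _ hq)))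
  · rw [he.image_inter]
    rcases hst with ⟨e1, e2⟩ | ⟨e1, e2⟩
    · rw [e1, e2]
    · rw [e1, e2, pair_comm]
  · rw [he.image_diff]
    exact isPreconnected_Ioo.image _ hr.continuousOn
  · rw [he.image_diff]
    rcases hst with ⟨e, -⟩ | ⟨-, e⟩ <;> rw [← e]
    exacts [(he.mem_closure hr).1, (he.mem_closure hr).2]
  · rw [disjoint_left]
    rintro _ ⟨u, hu, rfl⟩ ⟨v, hv, huv⟩
    obtain ⟨n, rfl⟩ := (h.right.eq_iff _ _).1 huv
    have e := he.eq_of_overlap (he'.shift h.right n) (by linarith [hu.1, hv.2])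
      (by linarith [hu.2, hv.1])
    have e1 : r s = r s' := (h.right.eq_iff _ _).2 ⟨n, e.1⟩
    have n1 := h.left.ne_of_lt hxz (by linarith)
    have n2 := h.left.ne_of_lt (hxz.trans (hzy.trans hyw)) hwx
    have n3 := h.left.ne_of_lt hzy (by linarith)
    have n4 := h.left.ne_of_lt hyw (by linarith)
    rcases hst with ⟨e2, -⟩ | ⟨e2, -⟩ <;> rcases hst' with ⟨e3, -⟩ | ⟨e3, -⟩ <;> rw [e2, e3] at e1
    exacts [n1 e1, n2 e1, n3 e1.symm, n4 e1]
  · rw [← he'.image_diff]; exact disjoint_sdiff_left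
  · rcases hst' with ⟨e, -⟩ | ⟨-, e⟩ <;> rw [← e]
    exacts [(he'.mem_closure hr).1, (he'.mem_closure hr).2]
  · rcases hst' with ⟨-, e⟩ | ⟨e, -⟩ <;> rw [← e]
    exacts [(he'.mem_closure hr).2, (he'.mem_closure hr).1]

end IsCrossingPair

section Arc

variable {b : ℝ → ℝ × ℝ} {p q : ℝ}

lemma isArc_image (hb : Continuous b) (hpq : p < q) (hinj : InjOn b (Icc p q)) :
    IsArc (b '' Icc p q) := by
  have he : IsClosedEmbedding ((Icc p q).domRestrict b) :=
    (hb.comp continuous_subtype_val).isClosedEmbedding (injOn_iff_injective.1 hinj)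
  have hrange : range ((Icc p q).domRestrict b) = b '' Icc p q := range_domRestrict _ _
  exact ⟨((Homeomorph.setCongr hrange.symm).trans he.isEmbedding.toHomeomorph.symm).trans
    (iccHomeoI p q hpq)⟩

lemma endpoints_image (hb : Continuous b) (hpq : p < q) (hinj : InjOn b (Icc p q)) :
    {a | IsEndpointOf a (b '' Icc p q)} = {b p, b q} := by
  have hsing : ∀ u ∈ Icc p q, b '' Icc p q \ {b u} = b '' (Icc p q \ {u}) := by
    intro u hu
    rw [hinj.image_sdiff_subset (singleton_subset_iff.2 hu), image_singleton]
  refine subset_antisymm ?_ ?_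
  · rintro _ ⟨⟨u, hu, rfl⟩, hconn⟩
    by_contra hne
    have hup : p < u := lt_of_le_of_ne hu.1 (by rintro rfl; exact hne (.inl rfl))
    have huq : u < q := lt_of_le_of_ne hu.2 (by rintro rfl; exact hne (.inr rfl))
    rw [hsing u hu] at hconn
    obtain ⟨_, ⟨y, hy, rfl⟩, ⟨v, hv, hvy⟩, ⟨w, hw, hwy⟩⟩ :=
      isPreconnected_closed_iff.1 hconn.isPreconnected (b '' Icc p u) (b '' Icc u q)
        (isCompact_Icc.image hb).isClosed (isCompact_Icc.image hb).isClosed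
        (by
          rw [← image_union, Icc_union_Icc_eq_Icc hup.le huq.le]
          exact image_mono sdiff_subset)
        ⟨b p, mem_image_of_mem _ ⟨left_mem_Icc.2 hpq.le, hup.ne⟩,
          mem_image_of_mem _ (left_mem_Icc.2 hup.le)⟩
        ⟨b q, mem_image_of_mem _ ⟨right_mem_Icc.2 hpq.le, huq.ne'⟩,
          mem_image_of_mem _ (right_mem_Icc.2 huq.le)⟩
    have e1 : v = y := hinj ⟨hv.1, hv.2.trans hu.2⟩ hy.1 hvy
    have e2 : w = y := hinj ⟨hu.1.trans hw.1, hw.2⟩ hy.1 hwy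
    subst e1 e2
    exact hy.2 (le_antisymm hv.2 hw.1)
  · rintro _ (rfl | rfl)
    · refine ⟨mem_image_of_mem _ (left_mem_Icc.2 hpq.le), ?_⟩
      rw [hsing p (left_mem_Icc.2 hpq.le), Icc_sdiff_left]
      exact (isConnected_Ioc hpq).image _ hb.continuousOn
    · refine ⟨mem_image_of_mem _ (right_mem_Icc.2 hpq.le), ?_⟩
      rw [hsing q (right_mem_Icc.2 hpq.le), Icc_sdiff_right]
      exact (isConnected_Ico hpq).image _ hb.continuousOn

end Arc

section Ears

variable {α : Type*} [LinearOrder α] {S : Set α} {M : α → α → Prop}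

/-- A noncrossing perfect matching of a finite set in a linear order has an innermost pair within
each of its pairs. -/
lemma exists_innermost (hS : S.Finite) (hsymm : ∀ x y, M x y → M y x)
    (htotal : ∀ x ∈ S, ∃ y ∈ S, M x y) (hne : ∀ x y, M x y → x ≠ y)
    (huniq : ∀ x ∈ S, ∀ y ∈ S, ∀ z ∈ S, M x y → M x z → y = z)
    (hcross : ∀ x ∈ S, ∀ z ∈ S, ∀ y ∈ S, ∀ w ∈ S, x < z → z < y → y < w → M x y → ¬ M z w)
    {x y : α} (hx : x ∈ S) (hy : y ∈ S) (hxy : x < y) (hM : M x y) :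
    ∃ p ∈ S, ∃ q ∈ S, x ≤ p ∧ p < q ∧ q ≤ y ∧ M p q ∧ ∀ z ∈ S, ¬ (p < z ∧ z < q) := by
  have hfin : {u : α × α | u.1 ∈ S ∧ u.2 ∈ S ∧ x ≤ u.1 ∧ u.1 < u.2 ∧ u.2 ≤ y ∧ M u.1 u.2}.Finite :=
    (hS.prod hS).subset fun u hu => ⟨hu.1, hu.2.1⟩
  obtain ⟨⟨p, q⟩, ⟨hp, hq, hxp, hpq, hqy, hMpq⟩, hmin⟩ := exists_min_image _
    (fun u => (S ∩ Ioo u.1 u.2).ncard) hfin ⟨(x, y), hx, hy, le_rfl, hxy, le_rfl, hM⟩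
  refine ⟨p, hp, q, hq, hxp, hpq, hqy, hMpq, ?_⟩
  rintro z hz ⟨hpz, hzq⟩
  obtain ⟨w, hw, hMw⟩ := htotal z hz
  have hwp : w ≠ p := by
    rintro rfl
    exact hzq.ne (huniq _ hp _ hz _ hq (hsymm _ _ hMw) hMpq)
  have hwq : w ≠ q := by
    rintro rfl
    exact hpz.ne (huniq _ hq _ hp _ hz (hsymm _ _ hMpq) (hsymm _ _ hMw))
  have hpw : p < w := by
    by_contra! hle
    exact hcross w hw p hp z hz q hq (lt_of_le_of_ne hle hwp) hpz hzq (hsymm _ _ hMw) hMpq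
  have hwq' : w < q := by
    by_contra! hle
    exact hcross p hp z hz q hq w hw hpz hzq (lt_of_le_of_ne hle hwq.symm) hMpq hMw
  have hsmall : ∀ c d, c ∈ S → d ∈ S → p < c → c < d → d < q → ¬ M c d := by
    intro c d hc hd hpc hcd hdq hMcd
    refine (hmin (c, d) ⟨hc, hd, hxp.trans hpc.le, hcd, hdq.le.trans hqy, hMcd⟩).not_gt ?_
    refine ncard_lt_ncard ⟨fun u hu => ⟨hu.1, hpc.trans hu.2.1, hu.2.2.trans hdq⟩, fun hsub => ?_⟩
      (hS.inter_of_left _)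
    exact (hsub ⟨hc, hpc, hcd.trans hdq⟩).2.1.false
  rcases lt_or_gt_of_ne (hne _ _ hMw) with hlt | hlt
  · exact hsmall z w hz hw hpz hlt hwq' hMw
  · exact hsmall w z hw hz hpw hlt hzq (hsymm _ _ hMw)

end Ears

namespace IsCrossingPair

variable {b r : ℝ → ℝ × ℝ} {C : ℝ × ℝ → Prop}

lemma exists_two_isEdge (h : IsCrossingPair b r) (hC : IsTwoColoring (range b) C)
    (hne : (range b ∩ range r).Nonempty) :
    ∃ p q p' q', IsEdge b (range r) p q ∧ IsEdge b (range r) p' q' ∧ q ≤ p' ∧ q' ≤ p + 1 ∧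
      IsMatched b r C (b p) (b q) ∧ IsMatched b r C (b p') (b q') := by
  obtain ⟨_, ⟨a, rfl⟩, ha⟩ := hne
  set S : Set ℝ := {t | b t ∈ range r} ∩ Ico a (a + 1) with hSdef
  have hS : S.Finite := h.symm.finite_visits fun x hx y hy => by linarith [hx.1, hy.2]
  have haS : a ∈ S := ⟨ha, by simp⟩
  have hinj : ∀ y ∈ S, ∀ z ∈ S, b y = b z → y = z := by
    intro y hy z hz hyz
    rcases lt_trichotomy y z with hlt | heq | hlt
    · exact (h.left.ne_of_lt hlt (by linarith [hy.2.1, hz.2.2]) hyz).elim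
    · exact heq
    · exact (h.left.ne_of_lt hlt (by linarith [hz.2.1, hy.2.2]) hyz.symm).elim
  have htotal : ∀ x ∈ S, ∃ y ∈ S, IsMatched b r C (b x) (b y) := by
    intro x hx
    obtain ⟨y, hy⟩ := h.exists_isMatched hC ⟨mem_range_self x, hx.1⟩
    have hyr := hy.symm.left_mem
    rw [h.left.range_eq a] at hyr
    obtain ⟨⟨t, ht, rfl⟩, htr⟩ := hyr
    exact ⟨t, ⟨htr, ht⟩, hy⟩
  have huniq : ∀ x ∈ S, ∀ y ∈ S, ∀ z ∈ S, IsMatched b r C (b x) (b y) →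
      IsMatched b r C (b x) (b z) → y = z := fun x _ y hy z hz hxy hxz =>
    hinj y hy z hz (h.isMatched_unique hC hxy hxz)
  have hnem : ∀ x y, IsMatched b r C (b x) (b y) → x ≠ y := by
    rintro x _ hxx rfl
    exact h.isMatched_ne hxx rfl
  have hcross : ∀ x ∈ S, ∀ z ∈ S, ∀ y ∈ S, ∀ w ∈ S, x < z → z < y → y < w →
      IsMatched b r C (b x) (b y) → ¬ IsMatched b r C (b z) (b w) :=
    fun x hx z _ y _ w hw hxz hzy hyw hxy hzw => h.isMatched_not_interlaced hC hxz hzy hyw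
      (by linarith [hx.2.1, hw.2.2]) hxy hzw
  have hear := fun x y hx hy hxy hM => exists_innermost
    (M := fun x y => IsMatched b r C (b x) (b y)) hS (fun _ _ => IsMatched.symm) htotal hnem huniq
    hcross (x := x) (y := y) hx hy hxy hM
  have hedge : ∀ p ∈ S, ∀ q ∈ S, p < q → (∀ z ∈ S, ¬ (p < z ∧ z < q)) →
      IsEdge b (range r) p q := fun p hp q hq hpq hz => ⟨hpq, hp.1, hq.1, fun u hu hur =>
    hz u ⟨hur, hp.2.1.trans hu.1.le, hu.2.trans hq.2.2⟩ hu⟩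
  obtain ⟨j, hj, hMj⟩ := htotal a haS
  have haj : a < j := lt_of_le_of_ne hj.2.1 (hnem _ _ hMj)
  obtain ⟨p, hp, q, hq, hap, hpq, hqj, hMpq, hpq0⟩ := hear a j haS hj haj hMj
  by_cases hmax : ∃ w ∈ S, j < w
  · obtain ⟨w, hw, hjw⟩ := hmax
    obtain ⟨v, hv, hMv⟩ := htotal w hw
    have hva : v ≠ a := by
      rintro rfl
      exact hjw.ne (huniq _ haS _ hj _ hw hMj hMv.symm)
    have hjv : j < v := by
      by_contra! hle
      rcases hle.eq_or_lt with rfl | hlt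
      · exact (haj.trans hjw).ne (huniq _ hj _ haS _ hw hMj.symm hMv.symm)
      · exact hcross a haS v hv j hj w hw (lt_of_le_of_ne hv.2.1 hva.symm) hlt hjw hMj hMv.symm
    have hfin : ∃ p' ∈ S, ∃ q' ∈ S, j ≤ p' ∧ p' < q' ∧ IsMatched b r C (b p') (b q') ∧
        ∀ z ∈ S, ¬ (p' < z ∧ z < q') := by
      rcases lt_or_gt_of_ne (hnem _ _ hMv) with hlt | hlt
      · obtain ⟨p', hp', q', hq', h1, h2, -, h3, h4⟩ := hear w v hw hv hlt hMv
        exact ⟨p', hp', q', hq', hjw.le.trans h1, h2, h3, h4⟩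
      · obtain ⟨p', hp', q', hq', h1, h2, -, h3, h4⟩ := hear v w hv hw hlt hMv.symm
        exact ⟨p', hp', q', hq', hjv.le.trans h1, h2, h3, h4⟩
    obtain ⟨p', hp', q', hq', h1, h2, h3, h4⟩ := hfin
    exact ⟨p, q, p', q', hedge p hp q hq hpq hpq0, hedge p' hp' q' hq' h2 h4, hqj.trans h1,
      by linarith [hq'.2.2], hMpq, h3⟩
  · push Not at hmax
    refine ⟨p, q, j, a + 1, hedge p hp q hq hpq hpq0, ⟨hj.2.2, hj.1, ?_, fun u hu hur => ?_⟩, hqj,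
      by linarith, hMpq, ?_⟩
    · rw [h.left.add_one]; exact ha
    · exact (hmax u ⟨hur, hj.2.1.trans hu.1.le, hu.2⟩).not_gt hu.1
    · rw [h.left.add_one]; exact hMj.symm

lemma exists_isDigon (h : IsCrossingPair b r) {p q : ℝ} (he : IsEdge b (range r) p q)
    (hM : IsMatched b r C (b p) (b q)) :
    ∃ γ, IsDigon (range b) (range r) (b '' Icc p q) γ ∧ (γ \ range b).Nonempty ∧
      ∀ u ∈ γ \ range b, C u := by
  obtain ⟨s, t, he', hC, hst⟩ := hM
  have hinj := h.left.injOn_Icc (h.symm.lt_add_one_of_isEdge he)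
  have hinj' := h.right.injOn_Icc (h.lt_add_one_of_isEdge he')
  have hset : ({r s, r t} : Set (ℝ × ℝ)) = {b p, b q} := by
    rcases hst with ⟨e1, e2⟩ | ⟨e1, e2⟩
    · rw [e1, e2]
    · rw [e1, e2, pair_comm]
  refine ⟨r '' Icc s t, ⟨isArc_image h.left.continuous he.lt hinj,
    isArc_image h.right.continuous he'.lt hinj', image_subset_range _ _, image_subset_range _ _,
    b p, b q, h.left.ne_of_lt he.lt (h.symm.lt_add_one_of_isEdge he),
    endpoints_image h.left.continuous he.lt hinj, ?_, ?_, ?_⟩, ?_, ?_⟩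
  · rw [endpoints_image h.right.continuous he'.lt hinj', hset]
  · rw [inter_comm, he'.image_inter, hset]
  · rw [inter_comm, he.image_inter]
  · rw [he'.image_diff]; exact ⟨_, mem_image_of_mem _ he'.midpoint_mem⟩
  · rw [he'.image_diff]
    rintro _ ⟨u, hu, rfl⟩
    exact hC u hu

lemma exists_two_isDigon (h : IsCrossingPair b r) (hC : IsTwoColoring (range b) C)
    (hne : (range b ∩ range r).Nonempty) :
    ∃ d d' : Set (ℝ × ℝ) × Set (ℝ × ℝ), IsDigon (range b) (range r) d.1 d.2 ∧
      IsDigon (range b) (range r) d'.1 d'.2 ∧ d ≠ d' ∧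
      (∃ u ∈ d.2 \ range b, C u) ∧ (∃ u ∈ d'.2 \ range b, C u) ∧
      (∀ u ∈ d.2 \ range b, C u) ∧ ∀ u ∈ d'.2 \ range b, C u := by
  obtain ⟨p, q, p', q', he, he', hqp, hqp', hM, hM'⟩ := h.exists_two_isEdge hC hne
  obtain ⟨γ, hd, ⟨u, hu⟩, hγ⟩ := h.exists_isDigon he hM
  obtain ⟨γ', hd', ⟨u', hu'⟩, hγ'⟩ := h.exists_isDigon he' hM'
  refine ⟨(b '' Icc p q, γ), (b '' Icc p' q', γ'), hd, hd', fun heq => ?_, ⟨u, hu, hγ u hu⟩,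
    ⟨u', hu', hγ' u' hu'⟩, hγ, hγ'⟩
  have hm := he.midpoint_mem
  have h1 : b ((p + q) / 2) ∈ b '' Icc p' q' := by
    have e : b '' Icc p q = b '' Icc p' q' := congrArg Prod.fst heq
    rw [← e]
    exact mem_image_of_mem _ (Ioo_subset_Icc_self hm)
  obtain ⟨v, hv, hvm⟩ := h1
  exact h.left.ne_of_lt (by linarith [hm.2, hv.1] : (p + q) / 2 < v)
    (by linarith [hm.1, hv.2]) hvm.symm

end IsCrossingPair

end Preliminaries

/-- If two non-disjoint simple closed curves intersect only in crossings, then there are at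
least 4 distinct digons of the pair. -/
theorem four_digons_of_crossings
    (β ρ : Set (ℝ × ℝ))
    (hβ : IsSimpleClosedCurve β) (hρ : IsSimpleClosedCurve ρ)
    (hne : (β ∩ ρ).Nonempty)
    (hcr : ∀ z ∈ β ∩ ρ, IsCrossing β ρ z) :
    ∃ d₁ d₂ d₃ d₄ : Set (ℝ × ℝ) × Set (ℝ × ℝ),
      IsDigon β ρ d₁.1 d₁.2 ∧ IsDigon β ρ d₂.1 d₂.2 ∧
      IsDigon β ρ d₃.1 d₃.2 ∧ IsDigon β ρ d₄.1 d₄.2 ∧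
      d₁ ≠ d₂ ∧ d₁ ≠ d₃ ∧ d₁ ≠ d₄ ∧ d₂ ≠ d₃ ∧ d₂ ≠ d₄ ∧ d₃ ≠ d₄ := by
  obtain ⟨b, hb, rfl⟩ := hβ.exists_isLoop
  obtain ⟨r, hr, rfl⟩ := hρ.exists_isLoop
  have h : IsCrossingPair b r := ⟨hb, hr, fun z hz => (hcr z hz).exists_chart⟩
  obtain ⟨C, hC⟩ := h.exists_isTwoColoring hne
  obtain ⟨d₁, d₂, h₁, h₂, h12, ⟨u₁, hu₁, hc₁⟩, ⟨u₂, hu₂, hc₂⟩, -, -⟩ := h.exists_two_isDigon hC hne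
  obtain ⟨d₃, d₄, h₃, h₄, h34, -, -, hc₃, hc₄⟩ := h.exists_two_isDigon hC.not hne
  refine ⟨d₁, d₂, d₃, d₄, h₁, h₂, h₃, h₄, h12, ?_, ?_, ?_, ?_, h34⟩
  · rintro rfl; exact hc₃ u₁ hu₁ hc₁
  · rintro rfl; exact hc₄ u₁ hu₁ hc₁
  · rintro rfl; exact hc₃ u₂ hu₂ hc₂
  · rintro rfl; exact hc₄ u₂ hu₂ hc₂
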